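/- arXiv:1512.03778 — 2 statements merged into one kernel-verified Lean document; each statement's English description precedes it below -/
import Mathlib

section
/- Suppose n ≥ 3, α ∈ (0,n), λ ≥ n/(n−2), and 0 ≤ σ < 1 − ((α−2)/n)·λ. If u is a nonnegative solution of the Choquard–Pekar inequality problem, then u(x) = O(1) as x → 0, and u has a C¹ extension to the origin, i.e. u = w restricted to ℝⁿ\{0} for some w ∈ C¹(ℝⁿ). -/
open MeasureTheory Metric Filter Set Asymptotics Topology

/-- `ℝⁿ` as a Euclidean space. -/
abbrev Euc (n : ℕ) : Type := EuclideanSpace ℝ (Fin n)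

/-- The Laplacian `Δu(x) = ∑ i ∂²u/∂xᵢ²(x)`. -/
noncomputable def lap {n : ℕ} (u : Euc n → ℝ) (x : Euc n) : ℝ :=
  ∑ i : Fin n, iteratedFDeriv ℝ 2 u x ![EuclideanSpace.single i 1, EuclideanSpace.single i 1]

/-- `u` is a nonnegative solution of the Choquard–Pekar inequality problem:
`u ∈ C²(ℝⁿ \ {0}) ∩ L^λ(ℝⁿ)` and
`0 ≤ -Δu(x) ≤ (∫ |x-y|^(-α) u(y)^λ dy) · u(x)^σ` on `B₂(0) \ {0}`. -/
def IsCPSolution (n : ℕ) (α lam sig : ℝ) (u : Euc n → ℝ) : Prop :=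
  (∀ x, 0 ≤ u x) ∧
  ContDiffOn ℝ 2 u {0}ᶜ ∧
  Integrable (fun y => u y ^ lam) ∧
  ∀ x ∈ ball (0 : Euc n) 2 \ {0},
    0 ≤ -lap u x ∧
    -lap u x ≤ (∫ y, ‖x - y‖ ^ (-α) * u y ^ lam) * u x ^ sig

open scoped ENNReal

section Lebesgue

variable {X : Type*} [MeasurableSpace X] {μ : Measure X}

theorem lintegral_mul_mul_norm_pow_le {f g h : X → ℝ≥0∞} (hf : AEMeasurable f μ)
    (hg : AEMeasurable g μ) (hh : AEMeasurable h μ) {p q r : ℝ} (hp : 0 ≤ p) (hq : 0 ≤ q)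
    (hr : 0 ≤ r) (hpqr : p + q + r = 1) :
    ∫⁻ a, f a ^ p * g a ^ q * h a ^ r ∂μ ≤
      (∫⁻ a, f a ∂μ) ^ p * (∫⁻ a, g a ∂μ) ^ q * (∫⁻ a, h a ∂μ) ^ r := by
  have := ENNReal.lintegral_prod_norm_pow_le (μ := μ) (Finset.univ : Finset (Fin 3))
    (f := ![f, g, h]) (p := ![p, q, r]) (by
      intro i _; fin_cases i <;> simpa) (by simpa [Fin.sum_univ_three] using hpqr) (by
      intro i _; fin_cases i <;> simpa)
  simpa [Fin.prod_univ_three] using this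

/-- Young's inequality for integral operators (qualitative form). -/
theorem lintegral_kernel_rpow_lt_top [SFinite μ] {k : X → X → ℝ≥0∞}
    (hk : Measurable (Function.uncurry k)) {f : X → ℝ≥0∞} (hf : Measurable f)
    {a b s : ℝ} (hs : 0 < s) (hsab : s = a + b - 1) (ha : a ≤ 1) (hb : b ≤ 1)
    {A : ℝ≥0∞} (hA : A ≠ ∞) (h1 : ∀ x, ∫⁻ y, k x y ^ (1 / b) ∂μ ≤ A)
    (h2 : ∀ y, ∫⁻ x, k x y ^ (1 / b) ∂μ ≤ A) (hfa : ∫⁻ y, f y ^ (1 / a) ∂μ < ∞) :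
    ∫⁻ x, (∫⁻ y, k x y * f y ∂μ) ^ (1 / s) ∂μ < ∞ := by
  have ha0 : 0 < a := by linarith
  have hb0 : 0 < b := by linarith
  have hbs : 0 ≤ b - s := by linarith
  have has : 0 ≤ a - s := by linarith
  have hkx : ∀ x, Measurable (k x) := fun x => hk.of_uncurry_left
  have key : ∀ x, (∫⁻ y, k x y * f y ∂μ) ^ (1 / s) ≤
      (∫⁻ y, k x y ^ (1 / b) * f y ^ (1 / a) ∂μ) *
        (A ^ (b - s) * (∫⁻ y, f y ^ (1 / a) ∂μ) ^ (a - s)) ^ (1 / s) := by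
    intro x
    have hpt : ∀ y, k x y * f y = (k x y ^ (1 / b) * f y ^ (1 / a)) ^ s *
        (k x y ^ (1 / b)) ^ (b - s) * (f y ^ (1 / a)) ^ (a - s) := by
      intro y
      rw [ENNReal.mul_rpow_of_nonneg _ _ hs.le, mul_right_comm _ _ ((k x y ^ (1 / b)) ^ (b - s)),
        ← ENNReal.rpow_add_of_nonneg _ _ hs.le hbs, mul_assoc,
        ← ENNReal.rpow_add_of_nonneg _ _ hs.le has, ← ENNReal.rpow_mul, ← ENNReal.rpow_mul]
      have e1 : 1 / b * (s + (b - s)) = 1 := by field_simp; ring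
      have e2 : 1 / a * (s + (a - s)) = 1 := by field_simp; ring
      rw [e1, e2, ENNReal.rpow_one, ENNReal.rpow_one]
    have hle : ∫⁻ y, k x y * f y ∂μ ≤ (∫⁻ y, k x y ^ (1 / b) * f y ^ (1 / a) ∂μ) ^ s *
        (A ^ (b - s) * (∫⁻ y, f y ^ (1 / a) ∂μ) ^ (a - s)) := by
      simp_rw [hpt]
      refine (lintegral_mul_mul_norm_pow_le (((hkx x).pow_const _).mul
        (hf.pow_const _)).aemeasurable ((hkx x).pow_const _).aemeasurable
        (hf.pow_const _).aemeasurable hs.le hbs has (by linarith)).trans ?_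
      rw [mul_assoc]
      exact mul_le_mul' le_rfl (mul_le_mul' (ENNReal.rpow_le_rpow (h1 x) hbs) le_rfl)
    calc (∫⁻ y, k x y * f y ∂μ) ^ (1 / s) ≤ _ := ENNReal.rpow_le_rpow hle (by positivity)
      _ = _ := by
        rw [ENNReal.mul_rpow_of_nonneg _ _ (by positivity : 0 ≤ 1 / s), ← ENNReal.rpow_mul,
          mul_one_div_cancel hs.ne', ENNReal.rpow_one]
  have hm : Measurable (Function.uncurry fun x y => k x y ^ (1 / b) * f y ^ (1 / a)) :=
    (hk.pow_const _).mul ((hf.pow_const _).comp measurable_snd)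
  have hC : (A ^ (b - s) * (∫⁻ y, f y ^ (1 / a) ∂μ) ^ (a - s)) ^ (1 / s) < ∞ :=
    ENNReal.rpow_lt_top_of_nonneg (by positivity) (ENNReal.mul_ne_top
      (ENNReal.rpow_ne_top_of_nonneg hbs hA) (ENNReal.rpow_ne_top_of_nonneg has hfa.ne))
  refine (lintegral_mono key).trans_lt ?_
  rw [lintegral_mul_const _ hm.lintegral_prod_right]
  refine ENNReal.mul_lt_top ?_ hC
  rw [lintegral_lintegral_swap hm.aemeasurable]
  calc _ = ∫⁻ y, (∫⁻ x, k x y ^ (1 / b) ∂μ) * f y ^ (1 / a) ∂μ := by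
        congr 1; ext y
        rw [lintegral_mul_const _ (hk.of_uncurry_right.pow_const _)]
    _ ≤ ∫⁻ y, A * f y ^ (1 / a) ∂μ := by gcongr with y; exact h2 y
    _ = A * ∫⁻ y, f y ^ (1 / a) ∂μ := lintegral_const_mul _ (hf.pow_const _)
    _ < ∞ := ENNReal.mul_lt_top hA.lt_top hfa

theorem lintegral_kernel_le {k : X → X → ℝ≥0∞}
    (hk : Measurable (Function.uncurry k)) {f : X → ℝ≥0∞} (hf : Measurable f)
    {a b : ℝ} (ha : 0 < a) (hb : 0 < b) (hab : a + b = 1)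
    {A : ℝ≥0∞} (h1 : ∀ x, ∫⁻ y, k x y ^ (1 / b) ∂μ ≤ A) (x : X) :
    ∫⁻ y, k x y * f y ∂μ ≤ A ^ b * (∫⁻ y, f y ^ (1 / a) ∂μ) ^ a := by
  have hkx : Measurable (k x) := hk.of_uncurry_left
  have hpt : ∀ y, k x y * f y = (k x y ^ (1 / b)) ^ b * (f y ^ (1 / a)) ^ a := by
    intro y
    rw [← ENNReal.rpow_mul, ← ENNReal.rpow_mul, one_div_mul_cancel ha.ne',
      one_div_mul_cancel hb.ne', ENNReal.rpow_one, ENNReal.rpow_one]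
  simp_rw [hpt]
  refine (ENNReal.lintegral_mul_norm_pow_le (hkx.pow_const _).aemeasurable
        (hf.pow_const _).aemeasurable hb.le ha.le (by linarith)).trans ?_
  gcongr
  exact h1 x

/-- Inclusion of Lebesgue spaces over a finite measure. -/
theorem lintegral_rpow_lt_top_of_le [IsFiniteMeasure μ] {f : X → ℝ≥0∞} {a b : ℝ} (ha : 0 < a)
    (hab : a ≤ b) (h : ∫⁻ y, f y ^ (1 / a) ∂μ < ∞) : ∫⁻ y, f y ^ (1 / b) ∂μ < ∞ := by
  have hb : 0 < b := ha.trans_le hab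
  have : ∀ y, f y ^ (1 / b) ≤ 1 + f y ^ (1 / a) := by
    intro y
    rcases le_total (f y) 1 with h1 | h1
    · exact (ENNReal.rpow_le_one h1 (by positivity)).trans le_self_add
    · exact (ENNReal.rpow_le_rpow_of_exponent_le h1
        (one_div_le_one_div_of_le ha hab)).trans le_add_self
  refine (lintegral_mono this).trans_lt ?_
  rw [lintegral_add_left measurable_const]
  simpa using h

theorem lintegral_const_add_mul_rpow_lt_top [IsFiniteMeasure μ] {f : X → ℝ≥0∞} {C D : ℝ≥0∞}
    (hC : C ≠ ∞) (hD : D ≠ ∞) {p : ℝ} (hp : 0 < p) (h : ∫⁻ y, f y ^ p ∂μ < ∞) :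
    ∫⁻ y, (C + D * f y) ^ p ∂μ < ∞ := by
  have : ∀ y, (C + D * f y) ^ p ≤ (2 * C) ^ p + (2 * D) ^ p * f y ^ p := by
    intro y
    rw [← ENNReal.mul_rpow_of_nonneg _ _ hp.le]
    rcases le_total C (D * f y) with h1 | h1
    · refine le_trans (ENNReal.rpow_le_rpow ?_ hp.le) le_add_self
      rw [mul_assoc, two_mul]; gcongr
    · refine le_trans (ENNReal.rpow_le_rpow ?_ hp.le) le_self_add
      rw [two_mul]; gcongr
  refine (lintegral_mono this).trans_lt ?_
  rw [lintegral_add_left measurable_const, lintegral_const_mul' _ _ (by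
    exact ENNReal.rpow_ne_top_of_nonneg hp.le (by finiteness))]
  refine ENNReal.add_lt_top.2 ⟨?_, ENNReal.mul_lt_top (ENNReal.rpow_lt_top_of_nonneg hp.le (by
    finiteness)) h⟩
  rw [lintegral_const]
  exact ENNReal.mul_lt_top (ENNReal.rpow_lt_top_of_nonneg hp.le (by finiteness))
    (measure_lt_top _ _)

theorem lintegral_mul_rpow_lt_top {f g : X → ℝ≥0∞} (hf : Measurable f) (hg : Measurable g)
    {s t σ : ℝ} (hs : 0 < s) (ht : 0 < t) (hσ : 0 ≤ σ) (hfs : ∫⁻ y, f y ^ (1 / s) ∂μ < ∞)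
    (hgt : ∫⁻ y, g y ^ (1 / t) ∂μ < ∞) :
    ∫⁻ y, (f y * g y ^ σ) ^ (1 / (s + σ * t)) ∂μ < ∞ := by
  have hd : 0 < s + σ * t := by positivity
  have hpt : ∀ y, (f y * g y ^ σ) ^ (1 / (s + σ * t)) =
      (f y ^ (1 / s)) ^ (s / (s + σ * t)) * (g y ^ (1 / t)) ^ (σ * t / (s + σ * t)) := by
    intro y
    rw [ENNReal.mul_rpow_of_nonneg _ _ (by positivity), ← ENNReal.rpow_mul, ← ENNReal.rpow_mul,
      ← ENNReal.rpow_mul]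
    congr 2 <;> field_simp
  simp_rw [hpt]
  refine (ENNReal.lintegral_mul_norm_pow_le (hf.pow_const _).aemeasurable
        (hg.pow_const _).aemeasurable (by positivity) (by positivity) (by field_simp)).trans_lt ?_
  exact ENNReal.mul_lt_top (ENNReal.rpow_lt_top_of_nonneg (by positivity) hfs.ne)
    (ENNReal.rpow_lt_top_of_nonneg (by positivity) hgt.ne)

end Lebesgue

section Riesz

variable {n : ℕ}

theorem lintegral_ball_norm_rpow_lt_top (hn : 0 < n) {γ : ℝ} (hγ : γ < n) (R : ℝ) :
    ∫⁻ z in ball (0 : Euc n) R, ENNReal.ofReal (‖z‖ ^ (-γ)) < ∞ := by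
  have : Nonempty (Fin n) := ⟨⟨0, hn⟩⟩
  have : Nontrivial (Euc n) := inferInstance
  have : IntegrableOn (fun z : Euc n => (‖z‖ ^ (-γ) : ℝ)) (ball 0 R) := by
    rw [integrableOn_fun_norm_addHaar volume (f := fun r : ℝ => r ^ (-γ))]
    have : IntegrableOn (fun y : ℝ => y ^ ((n : ℝ) - 1 - γ)) (Ioo 0 R) := by
      rcases le_or_gt R 0 with hR | hR
      · simp [Ioo_eq_empty_of_le hR]
      · have := (intervalIntegral.intervalIntegrable_rpow' (a := 0) (b := R)
          (r := (n : ℝ) - 1 - γ) (by linarith))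
        rw [intervalIntegrable_iff_integrableOn_Ioo_of_le hR.le] at this
        exact this
    refine this.congr_fun ?_ measurableSet_Ioo
    intro y hy
    simp only [finrank_euclideanSpace, Fintype.card_fin, smul_eq_mul]
    rw [← Real.rpow_natCast, ← Real.rpow_add hy.1, Nat.cast_sub (by omega)]
    congr 1; push_cast; ring
  exact this.lintegral_lt_top

/-- Uniform bound for Riesz kernels over balls. -/
theorem exists_lintegral_riesz_le (hn : 0 < n) {γ : ℝ} (hγ0 : 0 ≤ γ) (hγ : γ < n) (R : ℝ) :
    ∃ A : ℝ≥0∞, A ≠ ∞ ∧ ∀ x : Euc n,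
      ∫⁻ y in ball (0 : Euc n) R, ENNReal.ofReal (‖x - y‖ ^ (-γ)) ≤ A := by
  refine ⟨(∫⁻ z in ball (0 : Euc n) 1, ENNReal.ofReal (‖z‖ ^ (-γ))) +
    volume (ball (0 : Euc n) R), ?_, ?_⟩
  · exact ENNReal.add_ne_top.2 ⟨(lintegral_ball_norm_rpow_lt_top hn hγ 1).ne,
      measure_ball_lt_top.ne⟩
  · intro x
    have hpt : ∀ y ∈ ball (0 : Euc n) R, ENNReal.ofReal (‖x - y‖ ^ (-γ)) ≤
        (ball (0 : Euc n) 1).indicator (fun z => ENNReal.ofReal (‖z‖ ^ (-γ))) (x - y) + 1 := by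
      intro y _
      by_cases h : x - y ∈ ball (0 : Euc n) 1
      · rw [indicator_of_mem h]; exact le_self_add
      · refine le_trans ?_ le_add_self
        rw [ENNReal.ofReal_le_one]
        simp only [mem_ball, dist_zero_right, not_lt] at h
        exact Real.rpow_le_one_of_one_le_of_nonpos h (by linarith)
    calc _ ≤ ∫⁻ y in ball (0 : Euc n) R,
          ((ball (0 : Euc n) 1).indicator (fun z => ENNReal.ofReal (‖z‖ ^ (-γ))) (x - y) + 1) :=
            setLIntegral_mono' measurableSet_ball hpt
      _ = (∫⁻ y in ball (0 : Euc n) R,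
          (ball (0 : Euc n) 1).indicator (fun z => ENNReal.ofReal (‖z‖ ^ (-γ))) (x - y)) +
            volume (ball (0 : Euc n) R) := by
            rw [lintegral_add_right _ measurable_const]; simp
      _ ≤ _ := by
        refine add_le_add_left ((setLIntegral_le_lintegral _ _).trans ?_) _
        rw [lintegral_sub_left_eq_self (fun z => (ball (0 : Euc n) 1).indicator
          (fun z => ENNReal.ofReal (‖z‖ ^ (-γ))) z) x, lintegral_indicator measurableSet_ball]

theorem measurable_riesz (β : ℝ) :
    Measurable (Function.uncurry fun x y : Euc n => ENNReal.ofReal (‖x - y‖ ^ (-β))) := by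
  unfold Function.uncurry; fun_prop

theorem ofReal_rpow_neg_rpow (z : Euc n) (β : ℝ) {p : ℝ} (hp : 0 ≤ p) :
    ENNReal.ofReal (‖z‖ ^ (-β)) ^ p = ENNReal.ofReal (‖z‖ ^ (-(β * p))) := by
  rw [ENNReal.ofReal_rpow_of_nonneg (by positivity) hp, ← Real.rpow_mul (norm_nonneg _), neg_mul]

/-- Riesz potentials over a ball improve integrability. -/
theorem lintegral_riesz_rpow_lt_top (hn : 0 < n) {β a s R : ℝ} (hβ0 : 0 ≤ β) (hβ : β < n)
    (ha0 : 0 < a) (ha : a ≤ 1) (hs : 0 < s) (hsa : a + β / n - 1 < s) {f : Euc n → ℝ≥0∞}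
    (hf : Measurable f) (hfa : ∫⁻ y in ball (0 : Euc n) R, f y ^ (1 / a) < ∞) :
    ∫⁻ x in ball (0 : Euc n) R,
      (∫⁻ y in ball (0 : Euc n) R, ENNReal.ofReal (‖x - y‖ ^ (-β)) * f y) ^ (1 / s) < ∞ := by
  have hn' : (0 : ℝ) < n := by exact_mod_cast hn
  have : IsFiniteMeasure (volume.restrict (ball (0 : Euc n) R)) :=
    ⟨by simpa using measure_ball_lt_top⟩
  have main : ∀ r, 0 < r → a + β / n - 1 < r → r ≤ a → ∫⁻ x in ball (0 : Euc n) R,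
      (∫⁻ y in ball (0 : Euc n) R, ENNReal.ofReal (‖x - y‖ ^ (-β)) * f y) ^ (1 / r) < ∞ := by
    intro r hr hra hr1
    have hb : β / n < r + 1 - a := by linarith
    have hb0 : 0 < r + 1 - a := by linarith
    obtain ⟨A, hA, hA'⟩ := exists_lintegral_riesz_le hn (γ := β * (1 / (r + 1 - a)))
      (by positivity) (by
        rw [mul_one_div, div_lt_iff₀ hb0, mul_comm]; exact (div_lt_iff₀ hn').1 hb) R
    refine lintegral_kernel_rpow_lt_top (measurable_riesz β) hf hr (b := r + 1 - a) (by ring) ha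
      (by linarith) hA ?_ ?_ hfa
    · intro x
      simp_rw [ofReal_rpow_neg_rpow _ _ (by positivity : 0 ≤ 1 / (r + 1 - a))]
      exact hA' x
    · intro x
      simp_rw [ofReal_rpow_neg_rpow _ _ (by positivity : 0 ≤ 1 / (r + 1 - a)), norm_sub_rev _ x]
      exact hA' x
  rcases le_or_gt s a with h | h
  · exact main s hs hsa h
  · refine lintegral_rpow_lt_top_of_le ha0 h.le (main a ha0 ?_ le_rfl)
    have : β / n < 1 := (div_lt_one hn').2 hβ
    linarith

theorem exists_lintegral_riesz_mul_le (hn : 0 < n) {β a R : ℝ} (hβ0 : 0 ≤ β)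
    (ha0 : 0 < a) (ha : a + β / n < 1) {f : Euc n → ℝ≥0∞}
    (hf : Measurable f) (hfa : ∫⁻ y in ball (0 : Euc n) R, f y ^ (1 / a) < ∞) :
    ∃ M : ℝ≥0∞, M ≠ ∞ ∧ ∀ x,
      ∫⁻ y in ball (0 : Euc n) R, ENNReal.ofReal (‖x - y‖ ^ (-β)) * f y ≤ M := by
  have hn' : (0 : ℝ) < n := by exact_mod_cast hn
  have hb0 : 0 < 1 - a := by have : 0 ≤ β / n := by positivity
                             linarith
  obtain ⟨A, hA, hA'⟩ := exists_lintegral_riesz_le hn (γ := β * (1 / (1 - a)))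
      (by positivity) (by
        rw [mul_one_div, div_lt_iff₀ hb0, mul_comm]; exact (div_lt_iff₀ hn').1 (by linarith)) R
  refine ⟨_, ?_, fun x => lintegral_kernel_le (measurable_riesz β) hf ha0 hb0 (by ring)
    (A := A) ?_ x⟩
  · exact ENNReal.mul_ne_top (ENNReal.rpow_ne_top_of_nonneg hb0.le hA)
      (ENNReal.rpow_ne_top_of_nonneg ha0.le hfa.ne)
  · intro x
    simp_rw [ofReal_rpow_neg_rpow _ _ (by positivity : 0 ≤ 1 / (1 - a))]
    exact hA' x

end Riesz

theorem riesz_bootstrap_exponent {n α lam sig : ℝ} (hn : 0 < n) (hα0 : 0 < α)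
    (hlam0 : 0 < lam) (hlam1 : 1 ≤ lam) (hsig0 : 0 ≤ sig)
    (hsig1 : sig < 1 - (α - 2) / n * lam) :
    ∃ δ, 0 < δ ∧ ∀ t, 0 < t → t ≤ 1 / lam →
      max (lam * t + α / n - 1) 0 + sig * t - 2 / n + 2 * δ < t := by
  have h2n : 0 < 2 / n := by positivity
  have hαn : 0 < α / n := by positivity
  set L := 1 / lam with hL
  have hL0 : 0 < L := by positivity
  have hlL : lam * L = 1 := by rw [hL]; field_simp
  have hD : 0 < L - (α / n - 2 / n) - sig * L := by
    have := mul_lt_mul_of_pos_right hsig1 hL0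
    have e : (1 - (α - 2) / n * lam) * L = L - (α / n - 2 / n) * (lam * L) := by ring
    rw [e, hlL] at this
    linarith
  refine ⟨min (L - (α / n - 2 / n) - sig * L) (min (2 / n) (α / n)) / 3, ?_, ?_⟩
  · have := lt_min hD (lt_min h2n hαn)
    positivity
  · intro t ht htL
    set m := min (L - (α / n - 2 / n) - sig * L) (min (2 / n) (α / n)) with hm
    have hm0 : 0 < m := lt_min hD (lt_min h2n hαn)
    have hm1 : m ≤ L - (α / n - 2 / n) - sig * L := min_le_left _ _
    have hm2 : m ≤ 2 / n := (min_le_right _ _).trans (min_le_left _ _)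
    have hm3 : m ≤ α / n := (min_le_right _ _).trans (min_le_right _ _)
    rcases max_cases (lam * t + α / n - 1) 0 with ⟨h, _⟩ | ⟨h, _⟩
    · rw [h]
      have : 0 ≤ (lam + sig - 1) * (L - t) := mul_nonneg (by linarith) (by linarith)
      nlinarith
    · rw [h]
      rcases le_total sig 1 with h1 | h1
      · have : 0 ≤ (1 - sig) * t := mul_nonneg (by linarith) ht.le
        nlinarith
      · have : 0 ≤ (sig - 1) * (L - t) := mul_nonneg (by linarith) (by linarith)
        nlinarith

theorem riesz_bootstrap {n : ℕ} (hn : 3 ≤ n) {α lam sig : ℝ} (hα0 : 0 < α) (hαn : α < n)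
    (hlam : (n : ℝ) / ((n : ℝ) - 2) ≤ lam) (hsig0 : 0 ≤ sig)
    (hsig1 : sig < 1 - (α - 2) / (n : ℝ) * lam) {R : ℝ} {C : ℝ≥0∞} (hC : C ≠ ∞)
    {u : Euc n → ℝ≥0∞} (hu : Measurable u) (hulam : ∫⁻ y in ball (0 : Euc n) R, u y ^ lam < ∞)
    (H : ∀ᵐ x ∂(volume.restrict (ball (0 : Euc n) R)),
      u x ≤ C + C * ∫⁻ y in ball (0 : Euc n) R, ENNReal.ofReal (‖x - y‖ ^ (-((n : ℝ) - 2))) *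
        ((C + C * ∫⁻ z in ball (0 : Euc n) R, ENNReal.ofReal (‖y - z‖ ^ (-α)) * u z ^ lam)
          * u y ^ sig)) :
    ∃ M : ℝ≥0∞, M ≠ ∞ ∧ (∀ᵐ x ∂(volume.restrict (ball (0 : Euc n) R)), u x ≤ M) ∧
      ∀ y, ∫⁻ z in ball (0 : Euc n) R, ENNReal.ofReal (‖y - z‖ ^ (-α)) * u z ^ lam ≤ M := by
  have hn0 : 0 < n := by omega
  have hn3 : (3 : ℝ) ≤ n := by exact_mod_cast hn
  have hn' : (0 : ℝ) < n := by linarith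
  have hn2 : (0 : ℝ) < (n : ℝ) - 2 := by linarith
  have hlam1 : 1 ≤ lam := le_trans (by rw [le_div_iff₀ hn2]; linarith) hlam
  have hlam0 : 0 < lam := by linarith
  have hLn : 1 / lam + 2 / n ≤ 1 := by
    have h1 : (n : ℝ) ≤ lam * (n - 2) := by rwa [div_le_iff₀ hn2] at hlam
    rw [div_add_div _ _ hlam0.ne' hn'.ne', div_le_one (by positivity)]
    linarith
  have : IsFiniteMeasure (volume.restrict (ball (0 : Euc n) R)) :=
    ⟨by simpa using measure_ball_lt_top⟩
  obtain ⟨δ, hδ, hδt⟩ := riesz_bootstrap_exponent hn' hα0 hlam0 hlam1 hsig0 hsig1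
  set N : Euc n → ℝ≥0∞ := fun y =>
    ∫⁻ z in ball (0 : Euc n) R, ENNReal.ofReal (‖y - z‖ ^ (-α)) * u z ^ lam with hN
  have hNm : Measurable N := Measurable.lintegral_prod_right'
    (f := fun p : Euc n × Euc n => ENNReal.ofReal (‖p.1 - p.2‖ ^ (-α)) * u p.2 ^ lam)
    ((measurable_riesz α).mul ((hu.pow_const _).comp measurable_snd))
  set f : Euc n → ℝ≥0∞ := fun y => (C + C * N y) * u y ^ sig with hf
  have hfm : Measurable f := (measurable_const.add (hNm.const_mul C)).mul (hu.pow_const _)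
  have hulamt : ∀ t, 0 < t → ∫⁻ y in ball (0 : Euc n) R, u y ^ (1 / t) < ∞ →
      ∫⁻ y in ball (0 : Euc n) R, (u y ^ lam) ^ (1 / (lam * t)) < ∞ := by
    intro t ht h
    convert h using 3 with y
    rw [← ENNReal.rpow_mul]
    congr 1; field_simp
  have hfint : ∀ t s, 0 < t → t ≤ 1 / lam → 0 < s → lam * t + α / n - 1 < s →
      ∫⁻ y in ball (0 : Euc n) R, u y ^ (1 / t) < ∞ →
      ∫⁻ y in ball (0 : Euc n) R, f y ^ (1 / (s + sig * t)) < ∞ := by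
    intro t s ht htL hs hst hut
    have h1 : ∫⁻ y in ball (0 : Euc n) R, N y ^ (1 / s) < ∞ :=
      lintegral_riesz_rpow_lt_top hn0 hα0.le hαn (a := lam * t) (by positivity)
        (by rwa [mul_comm, ← le_div_iff₀ hlam0]) hs hst (hu.pow_const _) (hulamt t ht hut)
    exact lintegral_mul_rpow_lt_top (measurable_const.add (hNm.const_mul C)) hu hs ht hsig0
      (lintegral_const_add_mul_rpow_lt_top hC hC (by positivity) h1) hut
  have hstep : ∀ t t', 0 < t → t ≤ 1 / lam → 0 < t' → t - δ ≤ t' →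
      ∫⁻ y in ball (0 : Euc n) R, u y ^ (1 / t) < ∞ →
      ∫⁻ y in ball (0 : Euc n) R, u y ^ (1 / t') < ∞ := by
    intro t t' ht htL ht' htt' hut
    have hd := hδt t ht htL
    set s := max (lam * t + α / n - 1) 0 + δ with hs
    have hs0 : 0 < s := by have := le_max_right (lam * t + α / n - 1) 0; linarith
    have hs1 : lam * t + α / n - 1 < s := by
      have := le_max_left (lam * t + α / n - 1) 0; linarith
    have h1 := hfint t s ht htL hs0 hs1 hut
    have hst : 0 ≤ sig * t := by positivity
    have e : ((n : ℝ) - 2) / n = 1 - 2 / n := by field_simp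
    have h2 := lintegral_riesz_rpow_lt_top hn0 hn2.le (by linarith : (n : ℝ) - 2 < n)
      (a := s + sig * t) (s := t') (by positivity) (by linarith) ht' (by rw [e]; linarith) hfm h1
    refine lt_of_le_of_lt (lintegral_mono_ae ?_)
      (lintegral_const_add_mul_rpow_lt_top hC hC (by positivity) h2)
    filter_upwards [H] with x hx
    exact ENNReal.rpow_le_rpow hx (by positivity)
  have hall : ∀ k : ℕ, ∀ t, 0 < t → t ≤ 1 / lam → 1 / lam - k * δ ≤ t →
      ∫⁻ y in ball (0 : Euc n) R, u y ^ (1 / t) < ∞ := by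
    intro k
    induction k with
    | zero =>
      intro t ht htL h
      have : t = 1 / lam := le_antisymm htL (by simpa using h)
      rw [this]; simpa using hulam
    | succ k ih =>
      intro t ht htL h
      push_cast at h
      refine hstep (min (t + δ) (1 / lam)) t (lt_min (by linarith) (by positivity))
        (min_le_right _ _) ht (by have := min_le_left (t + δ) (1 / lam); linarith)
        (ih _ (lt_min (by linarith) (by positivity)) (min_le_right _ _) ?_)
      refine le_min (by linarith) ?_
      have : 0 ≤ k * δ := by positivity
      linarith
  have hall' : ∀ t, 0 < t → t ≤ 1 / lam → ∫⁻ y in ball (0 : Euc n) R, u y ^ (1 / t) < ∞ := by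
    intro t ht htL
    obtain ⟨k, hk⟩ := exists_nat_ge ((1 / lam) / δ)
    refine hall k t ht htL ?_
    rw [div_le_iff₀ hδ] at hk
    linarith
  have hαn' : 0 < 1 - α / n := by
    have : α / n < 1 := (div_lt_one hn').2 hαn
    linarith
  set t := min (1 / lam) (min ((1 - α / n) / (2 * lam)) (1 / (2 * n * (sig + 1)))) with ht
  have ht0 : 0 < t := lt_min (by positivity) (lt_min (by positivity) (by positivity))
  have htL : t ≤ 1 / lam := min_le_left _ _
  have ht1 : lam * t + α / n < 1 := by
    have : t ≤ (1 - α / n) / (2 * lam) := (min_le_right _ _).trans (min_le_left _ _)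
    rw [le_div_iff₀ (by positivity)] at this
    linarith
  have ht2 : sig * t ≤ 1 / (2 * n) := by
    have h1 : t ≤ 1 / (2 * n * (sig + 1)) := (min_le_right _ _).trans (min_le_right _ _)
    rw [le_div_iff₀ (by positivity)] at h1 ⊢
    nlinarith
  have hut := hall' t ht0 htL
  obtain ⟨M1, hM1, hM1'⟩ := exists_lintegral_riesz_mul_le hn0 hα0.le (a := lam * t)
    (by positivity) ht1 (hu.pow_const lam) (hulamt t ht0 hut)
  have h1 := hfint t (1 / n) ht0 htL (by positivity) (by
    have : (0 : ℝ) < 1 / n := by positivity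
    linarith) hut
  obtain ⟨M2, hM2, hM2'⟩ := exists_lintegral_riesz_mul_le hn0 hn2.le (a := 1 / n + sig * t)
    (by positivity) (by
      have : 1 / (2 * n) < 1 / (n : ℝ) := by gcongr; linarith
      have e : ((n : ℝ) - 2) / n = 1 - (1 / n + 1 / n) := by field_simp; ring
      rw [e]; linarith) hfm h1
  refine ⟨M1 + (C + C * M2), by finiteness, ?_, fun y => (hM1' y).trans le_self_add⟩
  filter_upwards [H] with x hx
  refine hx.trans (le_trans ?_ le_add_self)
  gcongr
  exact hM2' x

section Calculus

variable {n : ℕ}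

/-- The `i`-th partial derivative. -/
noncomputable def partialDeriv (i : Fin n) (f : Euc n → ℝ) (x : Euc n) : ℝ :=
  fderiv ℝ f x (EuclideanSpace.single i 1)

theorem contDiffAt_partialDeriv {i : Fin n} {f : Euc n → ℝ} {x : Euc n}
    {k m : WithTop ℕ∞} (hf : ContDiffAt ℝ k f x) (hkm : m + 1 ≤ k) :
    ContDiffAt ℝ m (partialDeriv i f) x :=
  (hf.fderiv_right hkm).clm_apply contDiffAt_const

theorem contDiff_partialDeriv {i : Fin n} {f : Euc n → ℝ}
    {k m : WithTop ℕ∞} (hf : ContDiff ℝ k f) (hkm : m + 1 ≤ k) :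
    ContDiff ℝ m (partialDeriv i f) :=
  contDiff_iff_contDiffAt.2 fun _ => contDiffAt_partialDeriv hf.contDiffAt hkm

theorem lap_eq_sum_partialDeriv {f : Euc n → ℝ} {x : Euc n} (hf : ContDiffAt ℝ 2 f x) :
    lap f x = ∑ i, partialDeriv i (partialDeriv i f) x := by
  unfold lap
  refine Finset.sum_congr rfl fun i _ => ?_
  have hd : DifferentiableAt ℝ (fderiv ℝ f) x :=
    (hf.fderiv_right (m := 1) (by norm_num)).differentiableAt (by norm_num)
  rw [iteratedFDeriv_two_apply]
  unfold partialDeriv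
  rw [fderiv_clm_apply hd (differentiableAt_const _)]
  simp

theorem lap_congr {f g : Euc n → ℝ} {x : Euc n} (h : f =ᶠ[𝓝 x] g) : lap f x = lap g x := by
  unfold lap
  rw [h.iteratedFDeriv ℝ 2 |>.eq_of_nhds]

theorem partialDeriv_congr (i : Fin n) {f g : Euc n → ℝ} {x : Euc n} (h : f =ᶠ[𝓝 x] g) :
    partialDeriv i f x = partialDeriv i g x := by
  unfold partialDeriv
  rw [h.fderiv_eq]

theorem partialDeriv_add (i : Fin n) {f g : Euc n → ℝ} {x : Euc n} (hf : DifferentiableAt ℝ f x)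
    (hg : DifferentiableAt ℝ g x) :
    partialDeriv i (fun y => f y + g y) x = partialDeriv i f x + partialDeriv i g x := by
  unfold partialDeriv
  rw [fderiv_fun_add hf hg]; simp

theorem partialDeriv_mul (i : Fin n) {f g : Euc n → ℝ} {x : Euc n} (hf : DifferentiableAt ℝ f x)
    (hg : DifferentiableAt ℝ g x) : partialDeriv i (fun y => f y * g y) x =
      f x * partialDeriv i g x + g x * partialDeriv i f x := by
  unfold partialDeriv
  rw [fderiv_fun_mul hf hg]; simp

theorem lap_mul {f g : Euc n → ℝ} {x : Euc n} (hf : ContDiffAt ℝ 2 f x)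
    (hg : ContDiffAt ℝ 2 g x) : lap (fun y => f y * g y) x =
      f x * lap g x + 2 * ∑ i, partialDeriv i f x * partialDeriv i g x + g x * lap f x := by
  rw [lap_eq_sum_partialDeriv (hf.mul hg), lap_eq_sum_partialDeriv hf, lap_eq_sum_partialDeriv hg,
    Finset.mul_sum, Finset.mul_sum, Finset.mul_sum, ← Finset.sum_add_distrib,
    ← Finset.sum_add_distrib]
  refine Finset.sum_congr rfl fun i _ => ?_
  have h1 : partialDeriv i (fun y => f y * g y) =ᶠ[𝓝 x]
      fun y => f y * partialDeriv i g y + g y * partialDeriv i f y := by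
    filter_upwards [hf.eventually (by simp), hg.eventually (by simp)] with y hy1 hy2
    exact partialDeriv_mul i (hy1.differentiableAt (by norm_num))
      (hy2.differentiableAt (by norm_num))
  have hf1 : DifferentiableAt ℝ f x := hf.differentiableAt (by norm_num)
  have hg1 : DifferentiableAt ℝ g x := hg.differentiableAt (by norm_num)
  have hf2 : DifferentiableAt ℝ (partialDeriv i f) x :=
    (contDiffAt_partialDeriv (m := 1) hf (by norm_num)).differentiableAt (by norm_num)
  have hg2 : DifferentiableAt ℝ (partialDeriv i g) x :=
    (contDiffAt_partialDeriv (m := 1) hg (by norm_num)).differentiableAt (by norm_num)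
  rw [partialDeriv_congr i h1, partialDeriv_add i (hf1.fun_mul hg2) (hg1.fun_mul hf2),
    partialDeriv_mul i hf1 hg2, partialDeriv_mul i hg1 hf2]
  ring

theorem partialDeriv_comp_smul (i : Fin n) (f : Euc n → ℝ) (c : ℝ) :
    partialDeriv i (fun x => f (c • x)) = fun x => c * partialDeriv i f (c • x) := by
  ext x
  unfold partialDeriv
  rw [fderiv_comp_smul]; simp

theorem partialDeriv_const_mul (i : Fin n) {f : Euc n → ℝ} (hf : Differentiable ℝ f) (c : ℝ) :
    partialDeriv i (fun x => c * f x) = fun x => c * partialDeriv i f x := by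
  ext x
  unfold partialDeriv
  rw [fderiv_const_mul (hf x)]; simp

theorem lap_comp_smul {f : Euc n → ℝ} (hf : ContDiff ℝ 2 f) (c : ℝ) (x : Euc n) :
    lap (fun x => f (c • x)) x = c ^ 2 * lap f (c • x) := by
  have h1 : ContDiff ℝ 2 fun x : Euc n => f (c • x) := hf.comp (contDiff_const_smul c)
  rw [lap_eq_sum_partialDeriv h1.contDiffAt, lap_eq_sum_partialDeriv hf.contDiffAt, Finset.mul_sum]
  refine Finset.sum_congr rfl fun i _ => ?_
  have h2 : ContDiff ℝ 1 (partialDeriv i f) := contDiff_partialDeriv hf (by norm_num)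
  have h3 : ContDiff ℝ 1 fun x : Euc n => partialDeriv i f (c • x) :=
    h2.comp (contDiff_const_smul c)
  rw [partialDeriv_comp_smul, partialDeriv_const_mul i (h3.differentiable (by norm_num)),
    partialDeriv_comp_smul]
  ring

theorem continuousOn_lap {f : Euc n → ℝ} {s : Set (Euc n)} (hs : IsOpen s)
    (hf : ContDiffOn ℝ 2 f s) : ContinuousOn (lap f) s := by
  have : ContinuousOn (fun x => ∑ i, partialDeriv i (partialDeriv i f) x) s := by
    refine continuousOn_finsetSum _ fun i _ x hx => ?_
    exact (contDiffAt_partialDeriv (m := 0) (contDiffAt_partialDeriv (m := 1)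
      (hf.contDiffAt (hs.mem_nhds hx)) (by norm_num)) (by norm_num)).continuousAt.continuousWithinAt
  exact this.congr fun x hx => lap_eq_sum_partialDeriv (hf.contDiffAt (hs.mem_nhds hx))

theorem continuous_lap {f : Euc n → ℝ} (hf : ContDiff ℝ 2 f) : Continuous (lap f) :=
  continuousOn_univ.1 (continuousOn_lap isOpen_univ hf.contDiffOn)

theorem hasCompactSupport_partialDeriv (i : Fin n) {f : Euc n → ℝ} (hf : HasCompactSupport f) :
    HasCompactSupport (partialDeriv i f) := hf.fderiv_apply ℝ _

theorem tsupport_partialDeriv_subset (i : Fin n) (f : Euc n → ℝ) :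
    tsupport (partialDeriv i f) ⊆ tsupport f := tsupport_fderiv_apply_subset ℝ _

theorem support_lap_subset (f : Euc n → ℝ) : Function.support (lap f) ⊆ tsupport f := by
  intro x hx
  by_contra h
  refine hx ?_
  have : f =ᶠ[𝓝 x] fun _ => 0 := notMem_tsupport_iff_eventuallyEq.1 h
  rw [lap_congr this]
  simp [lap]

theorem hasCompactSupport_lap {f : Euc n → ℝ} (hf : HasCompactSupport f) :
    HasCompactSupport (lap f) :=
  HasCompactSupport.of_support_subset_isCompact hf (support_lap_subset f)

theorem Continuous.mul_continuousOn_compl {φ ψ : Euc n → ℝ} (hφ : Continuous φ)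
    (h0 : (0 : Euc n) ∉ tsupport φ) (hψ : ContinuousOn ψ {0}ᶜ) :
    Continuous fun x => φ x * ψ x := by
  rw [continuous_iff_continuousAt]
  intro x
  by_cases hx : x ∈ tsupport φ
  · have hx0 : x ∈ ({0}ᶜ : Set (Euc n)) := by
      rintro rfl; exact h0 hx
    exact hφ.continuousAt.mul (hψ.continuousAt (isOpen_compl_singleton.mem_nhds hx0))
  · have : φ =ᶠ[𝓝 x] fun _ => 0 := notMem_tsupport_iff_eventuallyEq.1 hx
    refine (continuousAt_const (y := (0 : ℝ))).congr ?_
    filter_upwards [this] with y hy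
    rw [hy, zero_mul]

theorem integrable_mul_of_continuousOn_compl {φ ψ : Euc n → ℝ} (hφ : Continuous φ)
    (h0 : (0 : Euc n) ∉ tsupport φ) (hψ : ContinuousOn ψ {0}ᶜ) (hψc : HasCompactSupport ψ) :
    Integrable fun x => φ x * ψ x :=
  (hφ.mul_continuousOn_compl h0 hψ).integrable_of_hasCompactSupport hψc.mul_left

/-- Green's second identity for a function with an isolated singularity. -/
theorem integral_mul_lap {v ζ : Euc n → ℝ} (hv : ContDiffOn ℝ 2 v {0}ᶜ)
    (hvc : HasCompactSupport v) (hζ : ContDiff ℝ 2 ζ) (h0 : (0 : Euc n) ∉ tsupport ζ) :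
    ∫ x, ζ x * lap v x = ∫ x, v x * lap ζ x := by
  have hv' : ∀ x, x ≠ 0 → ContDiffAt ℝ 2 v x := fun x hx =>
    hv.contDiffAt (isOpen_compl_singleton.mem_nhds hx)
  have hv1 : ∀ i x, x ≠ 0 → ContDiffAt ℝ 1 (partialDeriv i v) x := fun i x hx =>
    contDiffAt_partialDeriv (hv' x hx) (by norm_num)
  have hv2 : ∀ i x, x ≠ 0 → ContDiffAt ℝ 0 (partialDeriv i (partialDeriv i v)) x := fun i x hx =>
    contDiffAt_partialDeriv (hv1 i x hx) (by norm_num)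
  have hζ1 : ∀ i, ContDiff ℝ 1 (partialDeriv i ζ) := fun i =>
    contDiff_partialDeriv hζ (by norm_num)
  have hζ2 : ∀ i, ContDiff ℝ 0 (partialDeriv i (partialDeriv i ζ)) := fun i =>
    contDiff_partialDeriv (hζ1 i) (by norm_num)
  have hne : ∀ x ∈ tsupport ζ, x ≠ 0 := by rintro x hx rfl; exact h0 hx
  have h01 : ∀ i, (0 : Euc n) ∉ tsupport (partialDeriv i ζ) := fun i h =>
    h0 (tsupport_partialDeriv_subset i ζ h)
  have h02 : ∀ i, (0 : Euc n) ∉ tsupport (partialDeriv i (partialDeriv i ζ)) := fun i h =>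
    h01 i (tsupport_partialDeriv_subset i _ h)
  have c0 : ContinuousOn v {0}ᶜ := hv.continuousOn
  have c1 : ∀ i, ContinuousOn (partialDeriv i v) {0}ᶜ := fun i x hx =>
    (hv1 i x hx).continuousAt.continuousWithinAt
  have c2 : ∀ i, ContinuousOn (partialDeriv i (partialDeriv i v)) {0}ᶜ := fun i x hx =>
    (hv2 i x hx).continuousAt.continuousWithinAt
  have s1 : ∀ i, HasCompactSupport (partialDeriv i v) := fun i =>
    hasCompactSupport_partialDeriv i hvc
  have s2 : ∀ i, HasCompactSupport (partialDeriv i (partialDeriv i v)) := fun i =>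
    hasCompactSupport_partialDeriv i (s1 i)
  have I1 : ∀ i, Integrable fun x => ζ x * partialDeriv i (partialDeriv i v) x := fun i =>
    integrable_mul_of_continuousOn_compl hζ.continuous h0 (c2 i) (s2 i)
  have I2 : ∀ i, Integrable fun x => partialDeriv i (partialDeriv i ζ) x * v x := fun i =>
    integrable_mul_of_continuousOn_compl (hζ2 i).continuous (h02 i) c0 hvc
  have I3 : ∀ i, Integrable fun x => partialDeriv i ζ x * partialDeriv i v x := fun i =>
    integrable_mul_of_continuousOn_compl (hζ1 i).continuous (h01 i) (c1 i) (s1 i)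
  have I4 : ∀ i, Integrable fun x => ζ x * partialDeriv i v x := fun i =>
    integrable_mul_of_continuousOn_compl hζ.continuous h0 (c1 i) (s1 i)
  have I5 : ∀ i, Integrable fun x => partialDeriv i ζ x * v x := fun i =>
    integrable_mul_of_continuousOn_compl (hζ1 i).continuous (h01 i) c0 hvc
  have e1 : ∀ x, ζ x * lap v x = ∑ i, ζ x * partialDeriv i (partialDeriv i v) x := by
    intro x
    rw [← Finset.mul_sum]
    by_cases hx : x = 0
    · have : ζ x = 0 := by rw [hx]; exact image_eq_zero_of_notMem_tsupport h0
      rw [this, zero_mul, zero_mul]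
    · rw [lap_eq_sum_partialDeriv (hv' x hx)]
  have e2 : ∀ x, v x * lap ζ x = ∑ i, partialDeriv i (partialDeriv i ζ) x * v x := by
    intro x
    rw [← Finset.sum_mul, lap_eq_sum_partialDeriv hζ.contDiffAt, mul_comm]
  simp_rw [e1, e2]
  rw [integral_finsetSum _ fun i _ => I1 i, integral_finsetSum _ fun i _ => I2 i]
  refine Finset.sum_congr rfl fun i _ => ?_
  have p1 : ∫ x, ζ x * partialDeriv i (partialDeriv i v) x =
      - ∫ x, partialDeriv i ζ x * partialDeriv i v x :=
    integral_mul_fderiv_eq_neg_fderiv_mul_of_integrable (I3 i) (I1 i) (I4 i)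
      (fun x _ => (hζ.differentiable (by norm_num)) x)
      (fun x hx => (hv1 i x (hne x hx)).differentiableAt (by norm_num))
  have p2 : ∫ x, partialDeriv i ζ x * partialDeriv i v x =
      - ∫ x, partialDeriv i (partialDeriv i ζ) x * v x :=
    integral_mul_fderiv_eq_neg_fderiv_mul_of_integrable (I2 i) (I3 i) (I5 i)
      (fun x _ => ((hζ1 i).differentiable (by norm_num)) x)
      (fun x hx => (hv' x (hne x (tsupport_partialDeriv_subset i ζ hx))).differentiableAt
        (by norm_num))
  rw [p1, p2, neg_neg]

end Calculus

section Cutoff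

variable {n : ℕ}

/-- A smooth function vanishing on the unit ball and equal to `1` outside the ball of radius `2`. -/
noncomputable def unitCutoff (n : ℕ) (x : Euc n) : ℝ :=
  1 - (⟨1, 2, by norm_num, by norm_num⟩ : ContDiffBump (0 : Euc n)) x

theorem contDiff_unitCutoff {k : ℕ∞} : ContDiff ℝ k (unitCutoff n) :=
  contDiff_const.sub (ContDiffBump.contDiff _)

theorem unitCutoff_nonneg (x : Euc n) : 0 ≤ unitCutoff n x :=
  sub_nonneg.2 (ContDiffBump.le_one _)

theorem unitCutoff_le_one (x : Euc n) : unitCutoff n x ≤ 1 :=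
  sub_le_self _ (ContDiffBump.nonneg _)

theorem unitCutoff_eq_zero {x : Euc n} (hx : ‖x‖ ≤ 1) : unitCutoff n x = 0 := by
  rw [unitCutoff, ContDiffBump.one_of_mem_closedBall _ (by simpa using hx), sub_self]

theorem unitCutoff_eq_one {x : Euc n} (hx : 2 ≤ ‖x‖) : unitCutoff n x = 1 := by
  rw [unitCutoff, ContDiffBump.zero_of_le_dist _ (by simpa using hx), sub_zero]

theorem unitCutoff_eventuallyEq_one {x : Euc n} (hx : 2 < ‖x‖) :
    unitCutoff n =ᶠ[𝓝 x] fun _ => 1 := by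
  filter_upwards [(isOpen_lt continuous_const continuous_norm).mem_nhds hx] with y hy
  exact unitCutoff_eq_one (le_of_lt hy)

theorem partialDeriv_unitCutoff_eq_zero (i : Fin n) {x : Euc n} (hx : 2 < ‖x‖) :
    partialDeriv i (unitCutoff n) x = 0 := by
  rw [partialDeriv_congr i (unitCutoff_eventuallyEq_one hx)]
  simp [partialDeriv]

theorem lap_unitCutoff_eq_zero {x : Euc n} (hx : 2 < ‖x‖) : lap (unitCutoff n) x = 0 := by
  rw [lap_congr (unitCutoff_eventuallyEq_one hx)]
  simp [lap, iteratedFDeriv_const_of_ne]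

theorem exists_forall_abs_le_of_continuous {f : Euc n → ℝ} (hf : Continuous f) {R : ℝ}
    (h0 : ∀ x, R < ‖x‖ → f x = 0) : ∃ C, 0 ≤ C ∧ ∀ x, |f x| ≤ C := by
  obtain ⟨C, hC⟩ := (isCompact_closedBall (0 : Euc n) R).exists_bound_of_continuousOn
    hf.continuousOn
  refine ⟨max C 0, le_max_right _ _, fun x => ?_⟩
  rcases le_or_gt ‖x‖ R with h | h
  · exact (hC x (by simpa using h)).trans (le_max_left _ _)
  · simp [h0 x h]

/-- The cutoff near the origin at scale `ε`. -/
noncomputable def originCutoff (n : ℕ) (ε : ℝ) (x : Euc n) : ℝ := unitCutoff n (ε⁻¹ • x)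

theorem contDiff_originCutoff (ε : ℝ) : ContDiff ℝ 2 (originCutoff n ε) :=
  (contDiff_unitCutoff (k := 2)).comp (contDiff_const_smul _)

theorem norm_inv_smul {ε : ℝ} (hε : 0 < ε) (x : Euc n) : ‖ε⁻¹ • x‖ = ‖x‖ / ε := by
  rw [norm_smul, norm_inv, Real.norm_of_nonneg hε.le]; ring

theorem originCutoff_eq_zero {ε : ℝ} (hε : 0 < ε) {x : Euc n} (hx : ‖x‖ ≤ ε) :
    originCutoff n ε x = 0 :=
  unitCutoff_eq_zero (by rw [norm_inv_smul hε]; exact (div_le_one hε).2 hx)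

theorem originCutoff_eq_one {ε : ℝ} (hε : 0 < ε) {x : Euc n} (hx : 2 * ε ≤ ‖x‖) :
    originCutoff n ε x = 1 :=
  unitCutoff_eq_one (by rw [norm_inv_smul hε]; exact (le_div_iff₀ hε).2 hx)

theorem zero_notMem_tsupport_originCutoff_mul {ε : ℝ} (hε : 0 < ε) (K : Euc n → ℝ) :
    (0 : Euc n) ∉ tsupport fun x => originCutoff n ε x * K x := by
  rw [notMem_tsupport_iff_eventuallyEq]
  filter_upwards [ball_mem_nhds (0 : Euc n) hε] with x hx
  rw [originCutoff_eq_zero hε (by simpa using (mem_ball.1 hx).le), zero_mul]; rfl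

theorem tendsto_originCutoff {x : Euc n} (hx : x ≠ 0) :
    Tendsto (fun ε => originCutoff n ε x) (𝓝[>] 0) (𝓝 1) := by
  refine tendsto_const_nhds.congr' ?_
  have hx' : 0 < ‖x‖ := norm_pos_iff.2 hx
  filter_upwards [Ioo_mem_nhdsGT (show (0 : ℝ) < ‖x‖ / 2 by positivity)] with ε hε
  exact (originCutoff_eq_one hε.1 (by linarith [hε.2])).symm

theorem abs_originCutoff_le_one (ε : ℝ) (x : Euc n) : |originCutoff n ε x| ≤ 1 := by
  rw [originCutoff, abs_of_nonneg (unitCutoff_nonneg _)]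
  exact unitCutoff_le_one _

theorem exists_abs_lap_originCutoff_mul_sub_le {K : Euc n → ℝ} (hK : ContDiff ℝ 2 K) :
    ∃ C, 0 ≤ C ∧ ∀ ε, 0 < ε → ε < 1 → ∀ x,
      |lap (fun y => originCutoff n ε y * K y) x - originCutoff n ε x * lap K x| ≤
        (ball (0 : Euc n) (3 * ε)).indicator (fun _ => C * (ε ^ 2)⁻¹) x := by
  have hF : ContDiff ℝ 2 (unitCutoff n) := contDiff_unitCutoff (k := 2)
  have hF1 : ∀ i, ∃ C, 0 ≤ C ∧ ∀ x, |partialDeriv i (unitCutoff n) x| ≤ C := fun i =>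
    exists_forall_abs_le_of_continuous (contDiff_partialDeriv (m := 1) hF (by norm_num)).continuous
      (R := 2) fun x hx => partialDeriv_unitCutoff_eq_zero i hx
  choose C1 hC1 hC1' using hF1
  obtain ⟨C2, hC2, hC2'⟩ := exists_forall_abs_le_of_continuous (continuous_lap hF)
    (R := 2) fun x hx => lap_unitCutoff_eq_zero hx
  have hK1 : ∀ i, ∃ C, ∀ x ∈ closedBall (0 : Euc n) 3, ‖partialDeriv i K x‖ ≤ C := fun i =>
    (isCompact_closedBall (0 : Euc n) 3).exists_bound_of_continuousOn
      (contDiff_partialDeriv (m := 1) hK (by norm_num)).continuous.continuousOn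
  choose D1 hD1 using hK1
  obtain ⟨D2, hD2⟩ := (isCompact_closedBall (0 : Euc n) 3).exists_bound_of_continuousOn
    hK.continuous.continuousOn
  have hD1n : ∀ i, 0 ≤ D1 i := fun i => (norm_nonneg _).trans (hD1 i 0 (by simp))
  have hD2n : 0 ≤ D2 := (norm_nonneg _).trans (hD2 0 (by simp))
  refine ⟨2 * ∑ i, C1 i * D1 i + D2 * C2, ?_, ?_⟩
  · have : 0 ≤ ∑ i, C1 i * D1 i := Finset.sum_nonneg fun i _ => mul_nonneg (hC1 i) (hD1n i)
    positivity
  intro ε hε hε1 x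
  have e : lap (fun y => originCutoff n ε y * K y) x - originCutoff n ε x * lap K x =
      2 * ∑ i, ε⁻¹ * partialDeriv i (unitCutoff n) (ε⁻¹ • x) * partialDeriv i K x +
        K x * ((ε⁻¹) ^ 2 * lap (unitCutoff n) (ε⁻¹ • x)) := by
    rw [lap_mul (contDiff_originCutoff ε).contDiffAt hK.contDiffAt]
    have h1 : ∀ i, partialDeriv i (originCutoff n ε) x =
        ε⁻¹ * partialDeriv i (unitCutoff n) (ε⁻¹ • x) := fun i =>
      congrFun (partialDeriv_comp_smul i (unitCutoff n) ε⁻¹) x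
    have h2 : lap (originCutoff n ε) x = (ε⁻¹) ^ 2 * lap (unitCutoff n) (ε⁻¹ • x) :=
      lap_comp_smul hF _ x
    simp_rw [h1, h2]
    ring
  rw [e]
  by_cases hx : x ∈ ball (0 : Euc n) (3 * ε)
  · rw [indicator_of_mem hx]
    have hx3 : x ∈ closedBall (0 : Euc n) 3 := by
      have : ‖x‖ < 3 * ε := by simpa using hx
      simp; linarith
    have hinv : ε⁻¹ ≤ (ε ^ 2)⁻¹ := by
      apply inv_anti₀ (by positivity); nlinarith
    have hb1 : |∑ i, ε⁻¹ * partialDeriv i (unitCutoff n) (ε⁻¹ • x) * partialDeriv i K x| ≤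
        (∑ i, C1 i * D1 i) * (ε ^ 2)⁻¹ := by
      rw [Finset.sum_mul]
      refine (Finset.abs_sum_le_sum_abs _ _).trans (Finset.sum_le_sum fun i _ => ?_)
      rw [abs_mul, abs_mul, abs_of_pos (inv_pos.2 hε)]
      calc ε⁻¹ * |partialDeriv i (unitCutoff n) (ε⁻¹ • x)| * |partialDeriv i K x|
          ≤ (ε ^ 2)⁻¹ * C1 i * D1 i :=
            mul_le_mul (mul_le_mul hinv (hC1' i _) (abs_nonneg _) (by positivity)) (hD1 i x hx3)
              (abs_nonneg _) (mul_nonneg (by positivity) (hC1 i))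
        _ = _ := by ring
    have hb2 : |K x * ((ε⁻¹) ^ 2 * lap (unitCutoff n) (ε⁻¹ • x))| ≤ D2 * C2 * (ε ^ 2)⁻¹ := by
      rw [abs_mul, abs_mul, abs_of_pos (by positivity : 0 < (ε⁻¹) ^ 2), inv_pow]
      calc |K x| * ((ε ^ 2)⁻¹ * |lap (unitCutoff n) (ε⁻¹ • x)|)
          ≤ D2 * ((ε ^ 2)⁻¹ * C2) :=
            mul_le_mul (hD2 x hx3) (mul_le_mul_of_nonneg_left (hC2' _) (by positivity))
              (by positivity) hD2n
        _ = _ := by ring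
    refine (abs_add_le _ _).trans ?_
    rw [abs_mul, abs_two]
    linarith
  · rw [indicator_of_notMem hx]
    have hx' : 2 < ‖ε⁻¹ • x‖ := by
      have : 3 * ε ≤ ‖x‖ := by simpa using hx
      rw [norm_inv_smul hε, lt_div_iff₀ hε]; linarith
    simp [partialDeriv_unitCutoff_eq_zero _ hx', lap_unitCutoff_eq_zero hx']

end Cutoff

section Removable

variable {n : ℕ}

theorem tendsto_inv_sq_mul_lintegral_ball (hn : 3 ≤ n) {lam : ℝ}
    (hlam : (n : ℝ) / ((n : ℝ) - 2) ≤ lam) {v : Euc n → ℝ≥0∞} (hv : Measurable v)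
    (hvl : ∫⁻ x, v x ^ lam < ∞) :
    Tendsto (fun ε : ℝ => ENNReal.ofReal ((ε ^ 2)⁻¹) * ∫⁻ x in ball (0 : Euc n) (3 * ε), v x)
      (𝓝[>] 0) (𝓝 0) := by
  have hn3 : (3 : ℝ) ≤ n := by exact_mod_cast hn
  have hn2 : (0 : ℝ) < (n : ℝ) - 2 := by linarith
  have hlam1 : 1 < lam := lt_of_lt_of_le (by rw [lt_div_iff₀ hn2]; linarith) hlam
  have hlam0 : 0 < lam := by linarith
  have hq : 0 ≤ 1 - 1 / lam := by
    rw [sub_nonneg, div_le_one hlam0]; exact hlam1.le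
  have hnq : 2 ≤ n * (1 - 1 / lam) := by
    rw [div_le_iff₀ hn2] at hlam
    have : (n : ℝ) / lam ≤ n - 2 := by rw [div_le_iff₀ hlam0]; linarith
    have e : (n : ℝ) * (1 - 1 / lam) = n - n / lam := by ring
    rw [e]; linarith
  have : Nonempty (Fin n) := ⟨⟨0, by omega⟩⟩
  have : Nontrivial (Euc n) := inferInstance
  set V := volume (ball (0 : Euc n) 1) with hV
  have hVt : V ≠ ∞ := measure_ball_lt_top.ne
  have hvol : Tendsto (fun ε : ℝ => volume (ball (0 : Euc n) (3 * ε))) (𝓝[>] 0) (𝓝 0) := by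
    have h1 : ∀ᶠ ε : ℝ in 𝓝[>] 0, ENNReal.ofReal ((3 * ε) ^ n) * V =
        volume (ball (0 : Euc n) (3 * ε)) := by
      filter_upwards [self_mem_nhdsWithin] with ε hε
      have hε : 0 < ε := hε
      rw [Measure.addHaar_ball _ _ (by positivity)]
      simp [hV]
    refine Tendsto.congr' h1 ?_
    have h2 : Tendsto (fun ε : ℝ => ENNReal.ofReal ((3 * ε) ^ n)) (𝓝[>] 0) (𝓝 0) := by
      have : Continuous fun ε : ℝ => ENNReal.ofReal ((3 * ε) ^ n) :=
        ENNReal.continuous_ofReal.comp (by fun_prop)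
      have := this.tendsto 0
      rw [mul_zero, zero_pow (by omega), ENNReal.ofReal_zero] at this
      exact this.mono_left nhdsWithin_le_nhds
    simpa using ENNReal.Tendsto.mul_const h2 (Or.inr hVt)
  have hI := tendsto_setLIntegral_zero hvl.ne hvol
  have hI' : Tendsto (fun ε : ℝ => 9 * V ^ (1 - 1 / lam) *
      (∫⁻ x in ball (0 : Euc n) (3 * ε), v x ^ lam) ^ (1 / lam)) (𝓝[>] 0) (𝓝 0) := by
    have h1 := (ENNReal.continuous_rpow_const (y := 1 / lam)).tendsto 0 |>.comp hI
    rw [ENNReal.zero_rpow_of_pos (by positivity)] at h1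
    have h2 := ENNReal.Tendsto.const_mul (a := 9 * V ^ (1 - 1 / lam)) h1
      (Or.inr (ENNReal.mul_ne_top (by norm_num) (ENNReal.rpow_ne_top_of_nonneg hq hVt)))
    simpa using h2
  refine tendsto_of_tendsto_of_tendsto_of_le_of_le' tendsto_const_nhds hI'
    (Eventually.of_forall fun _ => zero_le) ?_
  filter_upwards [Ioo_mem_nhdsGT (show (0 : ℝ) < 1 / 3 by norm_num)] with ε hε
  have hε0 : 0 < ε := hε.1
  have h3ε : 3 * ε ≤ 1 := by linarith [hε.2]
  have hH : ∫⁻ x in ball (0 : Euc n) (3 * ε), v x ≤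
      (∫⁻ x in ball (0 : Euc n) (3 * ε), v x ^ lam) ^ (1 / lam) *
        (volume (ball (0 : Euc n) (3 * ε))) ^ (1 - 1 / lam) := by
    have := ENNReal.lintegral_mul_norm_pow_le (μ := volume.restrict (ball (0 : Euc n) (3 * ε)))
      (f := fun x => v x ^ lam) (g := fun _ => 1) (hv.pow_const _).aemeasurable aemeasurable_const
      (p := 1 / lam) (q := 1 - 1 / lam) (by positivity) hq (by ring)
    simpa [← ENNReal.rpow_mul, hlam0.ne'] using this
  have hvb : (volume (ball (0 : Euc n) (3 * ε))) ^ (1 - 1 / lam) ≤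
      ENNReal.ofReal (9 * ε ^ 2) * V ^ (1 - 1 / lam) := by
    rw [Measure.addHaar_ball _ _ (by positivity), ENNReal.mul_rpow_of_nonneg _ _ hq]
    gcongr
    rw [ENNReal.ofReal_rpow_of_nonneg (by positivity) hq]
    apply ENNReal.ofReal_le_ofReal
    rw [← Real.rpow_natCast, ← Real.rpow_mul (by positivity)]
    calc (3 * ε) ^ _ ≤ (3 * ε) ^ (2 : ℝ) :=
          Real.rpow_le_rpow_of_exponent_ge (by positivity) h3ε (by simpa using hnq)
      _ = 9 * ε ^ 2 := by rw [Real.rpow_two]; ring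
  calc ENNReal.ofReal ((ε ^ 2)⁻¹) * ∫⁻ x in ball (0 : Euc n) (3 * ε), v x
      ≤ ENNReal.ofReal ((ε ^ 2)⁻¹) * ((∫⁻ x in ball (0 : Euc n) (3 * ε), v x ^ lam) ^ (1 / lam) *
        (ENNReal.ofReal (9 * ε ^ 2) * V ^ (1 - 1 / lam))) := by
        gcongr
        exact hH.trans (by gcongr)
    _ = (ENNReal.ofReal ((ε ^ 2)⁻¹) * ENNReal.ofReal (9 * ε ^ 2)) * V ^ (1 - 1 / lam) *
      (∫⁻ x in ball (0 : Euc n) (3 * ε), v x ^ lam) ^ (1 / lam) := by ring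
    _ = _ := by
      rw [← ENNReal.ofReal_mul (by positivity)]
      congr 2
      have : (ε ^ 2)⁻¹ * (9 * ε ^ 2) = 9 := by field_simp
      rw [this]; norm_num

end Removable

section Representation

variable {n : ℕ}

theorem exists_forall_abs_mul_le {v f : Euc n → ℝ} (hv : HasCompactSupport v)
    (hf : Continuous f) : ∃ C, ∀ x, ‖v x * f x‖ ≤ C * ‖v x‖ := by
  obtain ⟨C, hC⟩ := hv.isCompact.exists_bound_of_continuousOn hf.continuousOn
  refine ⟨C, fun x => ?_⟩
  by_cases hx : x ∈ tsupport v
  · rw [norm_mul, mul_comm]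
    exact mul_le_mul_of_nonneg_right (hC x hx) (norm_nonneg _)
  · simp [image_eq_zero_of_notMem_tsupport hx]

theorem MeasureTheory.Integrable.mul_continuous_of_hasCompactSupport {v f : Euc n → ℝ}
    (hvi : Integrable v) (hv : HasCompactSupport v) (hf : Continuous f) :
    Integrable fun x => v x * f x := by
  obtain ⟨C, hC⟩ := exists_forall_abs_mul_le hv hf
  exact (hvi.norm.const_mul C).mono' (hvi.1.mul hf.aestronglyMeasurable) (ae_of_all _ hC)

theorem ae_ne_zero (hn : 3 ≤ n) : ∀ᵐ x : Euc n, x ≠ 0 := by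
  have : Nonempty (Fin n) := ⟨⟨0, by omega⟩⟩
  have : Nontrivial (Euc n) := inferInstance
  exact Measure.ae_ne volume 0

theorem tendsto_integral_originCutoff_mul_lap (hn : 3 ≤ n) {lam : ℝ}
    (hlam : (n : ℝ) / ((n : ℝ) - 2) ≤ lam) {v K : Euc n → ℝ} (hv : ContDiffOn ℝ 2 v {0}ᶜ)
    (hvc : HasCompactSupport v) (hv0 : ∀ x, 0 ≤ v x) (hvi : Integrable v)
    (hvl : ∫⁻ x, ENNReal.ofReal (v x) ^ lam < ∞) (hK : ContDiff ℝ 2 K) :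
    Tendsto (fun ε => ∫ x, originCutoff n ε x * K x * lap v x) (𝓝[>] 0)
      (𝓝 (∫ x, v x * lap K x)) := by
  obtain ⟨C, hC0, hC⟩ := exists_abs_lap_originCutoff_mul_sub_le hK
  have hvm : Measurable v := measurable_of_continuousOn_compl_singleton 0 hv.continuousOn
  have hθK : ∀ ε, ContDiff ℝ 2 fun x => originCutoff n ε x * K x := fun ε =>
    (contDiff_originCutoff ε).mul hK
  have i1 : ∀ ε, Integrable fun x => v x * (lap (fun y => originCutoff n ε y * K y) x -
      originCutoff n ε x * lap K x) := fun ε =>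
    hvi.mul_continuous_of_hasCompactSupport hvc ((continuous_lap (hθK ε)).sub
      ((contDiff_originCutoff ε).continuous.mul (continuous_lap hK)))
  have i2 : ∀ ε, Integrable fun x => v x * (originCutoff n ε x * lap K x) := fun ε =>
    hvi.mul_continuous_of_hasCompactSupport hvc
      ((contDiff_originCutoff ε).continuous.mul (continuous_lap hK))
  have t1 : Tendsto (fun ε => ∫ x, v x * (lap (fun y => originCutoff n ε y * K y) x -
      originCutoff n ε x * lap K x)) (𝓝[>] 0) (𝓝 0) := by
    have h0 := ENNReal.Tendsto.const_mul (a := ENNReal.ofReal C)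
      (tendsto_inv_sq_mul_lintegral_ball hn hlam hvm.ennreal_ofReal hvl) (Or.inr (by simp))
    rw [mul_zero] at h0
    rw [tendsto_zero_iff_norm_tendsto_zero]
    have h1 := (ENNReal.tendsto_toReal ENNReal.zero_ne_top).comp h0
    rw [ENNReal.toReal_zero] at h1
    have hfin : ∀ᶠ ε : ℝ in 𝓝[>] 0, ENNReal.ofReal C * (ENNReal.ofReal ((ε ^ 2)⁻¹) *
        ∫⁻ x in ball (0 : Euc n) (3 * ε), ENNReal.ofReal (v x)) < 1 :=
      (tendsto_order.1 h0).2 1 (by simp)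
    refine squeeze_zero' (Eventually.of_forall fun _ => norm_nonneg _) ?_ h1
    filter_upwards [hfin, Ioo_mem_nhdsGT (show (0 : ℝ) < 1 by norm_num)] with ε hε1 hε
    rw [← toReal_enorm]
    refine ENNReal.toReal_mono (hε1.trans ENNReal.one_lt_top).ne ?_
    refine (enorm_integral_le_lintegral_enorm _).trans ?_
    beta_reduce
    rw [← mul_assoc, ← lintegral_const_mul _ hvm.ennreal_ofReal,
      ← lintegral_indicator measurableSet_ball]
    refine lintegral_mono fun x => ?_
    have h := hC ε hε.1 hε.2 x
    by_cases hx : x ∈ ball (0 : Euc n) (3 * ε)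
    · rw [indicator_of_mem hx] at h ⊢
      rw [enorm_mul, mul_comm, Real.enorm_of_nonneg (hv0 x), ← ENNReal.ofReal_mul hC0,
        Real.enorm_eq_ofReal_abs]
      gcongr
    · rw [indicator_of_notMem hx] at h ⊢
      rw [abs_nonpos_iff.1 h]; simp
  have t2 : Tendsto (fun ε => ∫ x, v x * (originCutoff n ε x * lap K x)) (𝓝[>] 0)
      (𝓝 (∫ x, v x * lap K x)) := by
    refine tendsto_integral_filter_of_dominated_convergence (fun x => ‖v x * lap K x‖)
      (Eventually.of_forall fun ε => (i2 ε).1) (Eventually.of_forall fun ε => ae_of_all _ fun x => ?_)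
      (hvi.mul_continuous_of_hasCompactSupport hvc (continuous_lap hK)).norm ?_
    · rw [norm_mul, norm_mul, norm_mul]
      have := abs_originCutoff_le_one ε x
      rw [← Real.norm_eq_abs] at this
      exact mul_le_mul_of_nonneg_left (mul_le_of_le_one_left (norm_nonneg _) this) (norm_nonneg _)
    · filter_upwards [ae_ne_zero hn] with x hx
      have := ((tendsto_originCutoff hx).mul_const (lap K x)).const_mul (v x)
      simpa using this
  have t := t1.add t2
  rw [zero_add] at t
  refine t.congr' ?_
  filter_upwards [self_mem_nhdsWithin] with ε hε
  rw [integral_mul_lap hv hvc (hθK ε) (zero_notMem_tsupport_originCutoff_mul hε K),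
    ← integral_add (i1 ε) (i2 ε)]
  congr 1; ext x; ring

/-- A function in `L^λ` that is superharmonic near an isolated singularity has integrable
Laplacian. -/
theorem integrable_lap (hn : 3 ≤ n) {lam : ℝ}
    (hlam : (n : ℝ) / ((n : ℝ) - 2) ≤ lam) {v : Euc n → ℝ} (hv : ContDiffOn ℝ 2 v {0}ᶜ)
    (hvc : HasCompactSupport v) (hv0 : ∀ x, 0 ≤ v x) (hvi : Integrable v)
    (hvl : ∫⁻ x, ENNReal.ofReal (v x) ^ lam < ∞) {r : ℝ} (hr : 0 < r)
    (hsup : ∀ x ∈ ball (0 : Euc n) r \ {0}, 0 ≤ -lap v x) : Integrable (lap v) := by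
  have hlc : ContinuousOn (lap v) {0}ᶜ := continuousOn_lap isOpen_compl_singleton hv
  have hlm : Measurable (lap v) := measurable_of_continuousOn_compl_singleton 0 hlc
  have hls : HasCompactSupport (lap v) := hasCompactSupport_lap hvc
  obtain ⟨ρ, hρ⟩ := hls.isCompact.isBounded.subset_closedBall 0
  have hcomp : IsCompact (closedBall (0 : Euc n) ρ \ ball 0 r) :=
    (isCompact_closedBall _ _).diff isOpen_ball
  obtain ⟨M, hM⟩ := hcomp.exists_bound_of_continuousOn
    (hlc.mono fun x hx (h0 : x = 0) => hx.2 (by rw [h0]; exact mem_ball_self hr))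
  set h : Euc n → ℝ := (closedBall (0 : Euc n) ρ).indicator fun _ => max M 0 with hh
  have hhi : Integrable h := by
    rw [hh, integrable_indicator_iff measurableSet_closedBall]
    exact integrableOn_const measure_closedBall_lt_top.ne
  have hh0 : ∀ x, 0 ≤ h x := fun x => indicator_nonneg (fun _ _ => le_max_right _ _) x
  have hpos : ∀ x, x ≠ 0 → 0 ≤ h x - lap v x := by
    intro x hx
    by_cases hxr : x ∈ ball (0 : Euc n) r
    · have := hsup x ⟨hxr, hx⟩
      linarith [hh0 x]
    by_cases hxρ : x ∈ closedBall (0 : Euc n) ρ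
    · have h1 := hM x ⟨hxρ, hxr⟩
      rw [Real.norm_eq_abs] at h1
      rw [hh, indicator_of_mem hxρ]
      linarith [le_max_left M 0, le_abs_self (lap v x)]
    · have : lap v x = 0 := by
        by_contra hne
        exact hxρ (hρ (subset_tsupport _ hne))
      linarith [hh0 x]
  suffices hs : Integrable fun x => h x - lap v x by
    have := hhi.sub hs
    refine this.congr (ae_of_all _ fun x => ?_)
    simp
  refine ⟨(hhi.1.sub hlm.aestronglyMeasurable), ?_⟩
  set ε : ℕ → ℝ := fun m => 1 / ((m : ℝ) + 1) with hε
  have hεt : Tendsto ε atTop (𝓝[>] 0) :=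
    tendsto_nhdsWithin_iff.2 ⟨tendsto_one_div_add_atTop_nhds_zero_nat,
      Eventually.of_forall fun m => by simp only [hε, mem_Ioi]; positivity⟩
  have hθi : ∀ m, Integrable fun x => originCutoff n (ε m) x * lap v x := fun m => by
    have hp : 0 < ε m := by simp only [hε]; positivity
    have := zero_notMem_tsupport_originCutoff_mul hp (fun _ : Euc n => (1 : ℝ))
    simp only [mul_one] at this
    exact integrable_mul_of_continuousOn_compl (contDiff_originCutoff _).continuous this hlc hls
  have hθh : ∀ m, Integrable fun x => originCutoff n (ε m) x * h x := fun m =>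
    hhi.bdd_mul (contDiff_originCutoff _).continuous.aestronglyMeasurable
      (ae_of_all _ fun x => by rw [Real.norm_eq_abs]; exact abs_originCutoff_le_one _ _)
  have hT := (tendsto_integral_originCutoff_mul_lap hn hlam hv hvc hv0 hvi hvl
    (contDiff_const (c := (1 : ℝ)))).comp hεt
  obtain ⟨B, hB⟩ := hT.bddBelow_range
  have hle : ∀ m, ∫⁻ x, ENNReal.ofReal (originCutoff n (ε m) x * (h x - lap v x)) ≤
      ENNReal.ofReal ((∫ x, h x) - B) := fun m => by
    rw [← ofReal_integral_eq_lintegral_ofReal]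
    · refine ENNReal.ofReal_le_ofReal ?_
      simp_rw [mul_sub]
      rw [integral_sub (hθh m) (hθi m)]
      have h1 : B ≤ ∫ x, originCutoff n (ε m) x * lap v x := by
        have := hB (mem_range_self m)
        simpa using this
      have h2 : ∫ x, originCutoff n (ε m) x * h x ≤ ∫ x, h x :=
        integral_mono (hθh m) hhi fun x => mul_le_of_le_one_left (hh0 x)
          ((le_abs_self _).trans (abs_originCutoff_le_one _ _))
      linarith
    · simp_rw [mul_sub]; exact (hθh m).sub (hθi m)
    · filter_upwards [ae_ne_zero hn] with x hx
      exact mul_nonneg (unitCutoff_nonneg _) (hpos x hx)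
  have hlim : ∫⁻ x, ENNReal.ofReal (h x - lap v x) ≤ ENNReal.ofReal ((∫ x, h x) - B) := by
    calc ∫⁻ x, ENNReal.ofReal (h x - lap v x)
        = ∫⁻ x, liminf (fun m => ENNReal.ofReal (originCutoff n (ε m) x * (h x - lap v x)))
            atTop := by
          refine lintegral_congr_ae ?_
          filter_upwards [ae_ne_zero hn] with x hx
          have := (((tendsto_originCutoff hx).comp hεt).mul_const (h x - lap v x))
          rw [one_mul] at this
          exact ((ENNReal.tendsto_ofReal this).liminf_eq).symm
      _ ≤ liminf (fun m => ∫⁻ x, ENNReal.ofReal (originCutoff n (ε m) x * (h x - lap v x)))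
            atTop := by
          refine lintegral_liminf_le fun m => ?_
          refine ENNReal.measurable_ofReal.comp
            ((contDiff_originCutoff _).continuous.measurable.mul (Measurable.sub ?_ hlm))
          exact measurable_const.indicator measurableSet_closedBall
      _ ≤ _ := liminf_le_of_le (by isBoundedDefault) fun b hb => by
          obtain ⟨m, hm⟩ := hb.exists
          exact hm.trans (hle m)
  rw [hasFiniteIntegral_iff_ofReal]
  · exact hlim.trans_lt ENNReal.ofReal_lt_top
  · filter_upwards [ae_ne_zero hn] with x hx
    exact hpos x hx

theorem integral_mul_lap_of_integrable (hn : 3 ≤ n) {lam : ℝ}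
    (hlam : (n : ℝ) / ((n : ℝ) - 2) ≤ lam) {v K : Euc n → ℝ} (hv : ContDiffOn ℝ 2 v {0}ᶜ)
    (hvc : HasCompactSupport v) (hv0 : ∀ x, 0 ≤ v x) (hvi : Integrable v)
    (hvl : ∫⁻ x, ENNReal.ofReal (v x) ^ lam < ∞) (hK : ContDiff ℝ 2 K)
    (hl : Integrable (lap v)) : ∫ x, K x * lap v x = ∫ x, v x * lap K x := by
  refine tendsto_nhds_unique ?_
    (tendsto_integral_originCutoff_mul_lap hn hlam hv hvc hv0 hvi hvl hK)
  have hli : Integrable fun x => lap v x * K x :=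
    hl.mul_continuous_of_hasCompactSupport (hasCompactSupport_lap hvc) hK.continuous
  refine tendsto_integral_filter_of_dominated_convergence (fun x => ‖lap v x * K x‖)
    (Eventually.of_forall fun ε => ?_) (Eventually.of_forall fun ε => ae_of_all _ fun x => ?_)
    hli.norm ?_
  · exact ((contDiff_originCutoff _).continuous.mul hK.continuous).aestronglyMeasurable.mul hl.1
  · rw [mul_assoc, norm_mul, mul_comm (K x)]
    have := abs_originCutoff_le_one ε x
    rw [← Real.norm_eq_abs] at this
    exact mul_le_of_le_one_left (norm_nonneg _) this
  · filter_upwards [ae_ne_zero hn] with x hx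
    have := ((tendsto_originCutoff hx).mul_const (K x * lap v x))
    simpa [mul_assoc] using this

end Representation

section RegularizedKernel

variable {n : ℕ}

theorem hasFDerivAt_norm_sub_sq_add_rpow {δ : ℝ} (hδ : 0 < δ) (p : ℝ) (x y : Euc n) :
    HasFDerivAt (fun y : Euc n => (‖y - x‖ ^ 2 + δ ^ 2) ^ p)
      ((2 * p * (‖y - x‖ ^ 2 + δ ^ 2) ^ (p - 1)) • innerSL ℝ (y - x)) y := by
  have h1 : HasFDerivAt (fun y : Euc n => ‖y - x‖ ^ 2 + δ ^ 2)
      (2 • (innerSL ℝ (y - x)).comp (ContinuousLinearMap.id ℝ (Euc n))) y :=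
    (((hasFDerivAt_id y).sub_const x).norm_sq).add_const _
  have hpos : 0 < ‖y - x‖ ^ 2 + δ ^ 2 := by positivity
  have h2 := h1.rpow_const (p := p) (Or.inl hpos.ne')
  refine h2.congr_fderiv ?_
  ext z
  simp
  ring

theorem contDiff_norm_sub_sq_add_rpow {δ : ℝ} (hδ : 0 < δ) (p : ℝ) (x : Euc n) {k : ℕ∞} :
    ContDiff ℝ k fun y : Euc n => (‖y - x‖ ^ 2 + δ ^ 2) ^ p := by
  refine ContDiff.rpow_const_of_ne ?_ fun y => ?_
  · exact ((contDiff_id.sub contDiff_const).norm_sq ℝ).add contDiff_const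
  · have : 0 < ‖y - x‖ ^ 2 + δ ^ 2 := by positivity
    exact this.ne'

theorem partialDeriv_norm_sub_sq_add_rpow {δ : ℝ} (hδ : 0 < δ) (p : ℝ) (x : Euc n) (i : Fin n) :
    partialDeriv i (fun y : Euc n => (‖y - x‖ ^ 2 + δ ^ 2) ^ p) =
      fun y => 2 * p * ((‖y - x‖ ^ 2 + δ ^ 2) ^ (p - 1) * (y i - x i)) := by
  ext y
  rw [partialDeriv, (hasFDerivAt_norm_sub_sq_add_rpow hδ p x y).fderiv]
  simp [EuclideanSpace.inner_single_right]
  ring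

theorem lap_norm_sub_sq_add_rpow {δ : ℝ} (hδ : 0 < δ) (x y : Euc n) :
    lap (fun y : Euc n => (‖y - x‖ ^ 2 + δ ^ 2) ^ (-((n : ℝ) - 2) / 2)) y =
      -(((n : ℝ) - 2) * n) * (δ ^ 2 * (‖y - x‖ ^ 2 + δ ^ 2) ^ (-((n : ℝ) + 2) / 2)) := by
  have hpos : 0 < ‖y - x‖ ^ 2 + δ ^ 2 := by positivity
  rw [lap_eq_sum_partialDeriv (contDiff_norm_sub_sq_add_rpow (k := 2) hδ _ x).contDiffAt]
  set p : ℝ := -((n : ℝ) - 2) / 2 with hp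
  have hterm : ∀ i, partialDeriv i (partialDeriv i
      fun y : Euc n => (‖y - x‖ ^ 2 + δ ^ 2) ^ p) y =
      2 * p * ((‖y - x‖ ^ 2 + δ ^ 2) ^ (p - 1)) +
        2 * p * (2 * (p - 1) * ((‖y - x‖ ^ 2 + δ ^ 2) ^ (p - 1 - 1))) * (y i - x i) ^ 2 := by
    intro i
    have hc : Differentiable ℝ fun y : Euc n => (‖y - x‖ ^ 2 + δ ^ 2) ^ (p - 1) :=
      (contDiff_norm_sub_sq_add_rpow (k := 2) hδ (p - 1) x).differentiable (by norm_num)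
    have hl : HasFDerivAt (fun y : Euc n => y i - x i)
        (EuclideanSpace.proj i : Euc n →L[ℝ] ℝ) y :=
      (EuclideanSpace.proj i : Euc n →L[ℝ] ℝ).hasFDerivAt.sub_const _
    have hld : Differentiable ℝ fun y : Euc n => y i - x i := by fun_prop
    rw [partialDeriv_norm_sub_sq_add_rpow hδ, partialDeriv_const_mul i (hc.fun_mul hld)]
    beta_reduce
    rw [partialDeriv_mul i (hc y) (hld y), partialDeriv_norm_sub_sq_add_rpow hδ]
    have : partialDeriv i (fun y : Euc n => y i - x i) y = 1 := by
      rw [partialDeriv, hl.fderiv]; simp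
    rw [this]
    ring
  have hQ : ‖y - x‖ ^ 2 = ∑ i, (y i - x i) ^ 2 := by
    rw [EuclideanSpace.real_norm_sq_eq]; simp
  simp_rw [hterm]
  rw [Finset.sum_add_distrib, Finset.sum_const, ← Finset.mul_sum, ← hQ]
  have e1 : (‖y - x‖ ^ 2 + δ ^ 2) ^ (p - 1) =
      (‖y - x‖ ^ 2 + δ ^ 2) ^ (p - 1 - 1) * (‖y - x‖ ^ 2 + δ ^ 2) := by
    rw [← Real.rpow_add_one hpos.ne']; ring_nf
  have e2 : -((n : ℝ) + 2) / 2 = p - 1 - 1 := by rw [hp]; ring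
  rw [e1, e2, Finset.card_univ, Fintype.card_fin, nsmul_eq_mul]
  have e3 : 2 * (p - 1) = -(n : ℝ) := by rw [hp]; ring
  have e4 : 2 * p = -((n : ℝ) - 2) := by rw [hp]; ring
  rw [e3, e4]
  ring

theorem integrable_indicator_riesz (hn : 0 < n) {γ : ℝ} (hγ : γ < n) (x : Euc n) (r : ℝ) :
    Integrable ((ball x r).indicator fun y => ‖x - y‖ ^ (-γ)) := by
  have h0 : Integrable ((ball (0 : Euc n) r).indicator fun z => ‖z‖ ^ (-γ)) := by
    rw [integrable_indicator_iff measurableSet_ball]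
    refine ⟨Measurable.aestronglyMeasurable (by fun_prop), ?_⟩
    rw [hasFiniteIntegral_iff_ofReal (ae_of_all _ fun z => by positivity)]
    exact lintegral_ball_norm_rpow_lt_top hn hγ r
  refine (h0.comp_sub_left x).congr (ae_of_all _ fun y => ?_)
  by_cases hy : y ∈ ball x r
  · have hy' : x - y ∈ ball (0 : Euc n) r := by simpa [dist_eq_norm, norm_sub_rev] using hy
    simp only [indicator_of_mem hy, indicator_of_mem hy']
  · have hy' : x - y ∉ ball (0 : Euc n) r := by simpa [dist_eq_norm, norm_sub_rev] using hy
    simp only [indicator_of_notMem hy, indicator_of_notMem hy']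

theorem integrable_riesz_mul (hn : 0 < n) {γ : ℝ} (hγ0 : 0 ≤ γ) (hγ : γ < n) {f : Euc n → ℝ}
    (hf : Integrable f) {x : Euc n} {r M : ℝ} (hr : 0 < r) (hM : ∀ y ∈ ball x r, |f y| ≤ M) :
    Integrable fun y => ‖x - y‖ ^ (-γ) * f y := by
  refine (((integrable_indicator_riesz hn hγ x r).mul_const M).add
    (hf.norm.const_mul (r ^ (-γ)))).mono' ?_ (ae_of_all _ fun y => ?_)
  · exact AEStronglyMeasurable.mul (Measurable.aestronglyMeasurable (by fun_prop)) hf.1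
  have hk : 0 ≤ ‖x - y‖ ^ (-γ) := by positivity
  have hrp : 0 ≤ r ^ (-γ) := by positivity
  simp only [Pi.add_apply]
  rw [norm_mul, Real.norm_of_nonneg hk, Real.norm_eq_abs]
  by_cases hy : y ∈ ball x r
  · rw [indicator_of_mem hy]
    have := mul_le_mul_of_nonneg_left (hM y hy) hk
    have : 0 ≤ r ^ (-γ) * |f y| := by positivity
    linarith
  · rw [indicator_of_notMem hy, zero_mul, zero_add]
    have hy' : r ≤ ‖x - y‖ := by simpa [dist_eq_norm, norm_sub_rev] using hy
    exact mul_le_mul_of_nonneg_right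
      (Real.rpow_le_rpow_of_nonpos hr hy' (by linarith)) (abs_nonneg _)

theorem norm_sq_add_rpow_le {γ : ℝ} (hγ : 0 ≤ γ) (δ : ℝ) {z : Euc n} (hz : z ≠ 0) :
    (‖z‖ ^ 2 + δ ^ 2) ^ (-γ / 2) ≤ ‖z‖ ^ (-γ) := by
  have hz' : 0 < ‖z‖ := norm_pos_iff.2 hz
  have e : ‖z‖ ^ (-γ) = (‖z‖ ^ 2) ^ (-γ / 2) := by
    rw [← Real.rpow_natCast, ← Real.rpow_mul (norm_nonneg _)]
    congr 1; push_cast; ring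
  rw [e]
  exact Real.rpow_le_rpow_of_nonpos (by positivity) (by nlinarith [sq_nonneg δ]) (by linarith)

theorem tendsto_norm_sq_add_rpow (γ : ℝ) {z : Euc n} (hz : z ≠ 0) {ι : Type*} {l : Filter ι}
    {δ : ι → ℝ} (hδ : Tendsto δ l (𝓝 0)) :
    Tendsto (fun i => (‖z‖ ^ 2 + δ i ^ 2) ^ (-γ / 2)) l (𝓝 (‖z‖ ^ (-γ))) := by
  have hz' : 0 < ‖z‖ := norm_pos_iff.2 hz
  have e : ‖z‖ ^ (-γ) = (‖z‖ ^ 2 + 0 ^ 2) ^ (-γ / 2) := by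
    rw [zero_pow two_ne_zero, add_zero, ← Real.rpow_natCast, ← Real.rpow_mul (norm_nonneg _)]
    congr 1; push_cast; ring
  rw [e]
  refine Tendsto.rpow_const ((hδ.pow 2).const_add _) (Or.inl ?_)
  positivity

theorem tendsto_integral_norm_sq_add_rpow_mul (hn : 3 ≤ n) {γ : ℝ} (hγ : 0 ≤ γ) {f : Euc n → ℝ}
    (hf : AEStronglyMeasurable f) {x : Euc n} (hi : Integrable fun y => ‖x - y‖ ^ (-γ) * f y)
    {ι : Type*} {l : Filter ι} [l.IsCountablyGenerated] {δ : ι → ℝ} (hδ : Tendsto δ l (𝓝 0)) :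
    Tendsto (fun i => ∫ y, (‖x - y‖ ^ 2 + δ i ^ 2) ^ (-γ / 2) * f y) l
      (𝓝 (∫ y, ‖x - y‖ ^ (-γ) * f y)) := by
  have : Nonempty (Fin n) := ⟨⟨0, by omega⟩⟩
  have : Nontrivial (Euc n) := inferInstance
  have hae : ∀ᵐ y : Euc n, x - y ≠ 0 := by
    filter_upwards [Measure.ae_ne volume x] with y hy
    exact sub_ne_zero.2 hy.symm
  refine tendsto_integral_filter_of_dominated_convergence (fun y => ‖‖x - y‖ ^ (-γ) * f y‖)
    (Eventually.of_forall fun i => ?_) (Eventually.of_forall fun i => ?_) hi.norm ?_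
  · exact AEStronglyMeasurable.mul (Measurable.aestronglyMeasurable (by fun_prop)) hf
  · filter_upwards [hae] with y hy
    rw [norm_mul, norm_mul,
      Real.norm_of_nonneg (show 0 ≤ (‖x - y‖ ^ 2 + δ i ^ 2) ^ (-γ / 2) by positivity),
      Real.norm_of_nonneg (show 0 ≤ ‖x - y‖ ^ (-γ) by positivity)]
    exact mul_le_mul_of_nonneg_right (norm_sq_add_rpow_le hγ _ hy) (norm_nonneg _)
  · filter_upwards [hae] with y hy
    exact (tendsto_norm_sq_add_rpow γ hy hδ).mul_const _

theorem exists_tendsto_integral_peak (hn : 3 ≤ n) : ∃ I : ℝ, 0 < I ∧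
    ∀ {v : Euc n → ℝ} {x : Euc n}, Integrable v → ContinuousAt v x →
      Tendsto (fun c : ℝ => ∫ y, v y * ((c⁻¹) ^ 2 * (‖x - y‖ ^ 2 + (c⁻¹) ^ 2) ^ (-((n : ℝ) + 2) / 2)))
        atTop (𝓝 (I * v x)) := by
  have : Nonempty (Fin n) := ⟨⟨0, by omega⟩⟩
  have : Nontrivial (Euc n) := inferInstance
  obtain ⟨ψ, hψ⟩ : ∃ ψ : Euc n → ℝ, ψ = fun z => ((1 : ℝ) + ‖z‖ ^ 2) ^ (-((n : ℝ) + 2) / 2) :=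
    ⟨_, rfl⟩
  have hψi : Integrable ψ := hψ ▸ integrable_rpow_neg_one_add_norm_sq (r := (n : ℝ) + 2) (by simp)
  have hψ0 : ∀ z, 0 < ψ z := fun z => by simp only [hψ]; positivity
  have hI : 0 < ∫ z, ψ z := by
    rw [integral_pos_iff_support_of_nonneg (fun z => (hψ0 z).le) hψi]
    have : Function.support ψ = univ := by
      ext z; simp [(hψ0 z).ne']
    rw [this]
    exact Measure.measure_univ_pos.2 (NeZero.ne _)
  obtain ⟨I, hIdef⟩ : ∃ I, I = ∫ z, ψ z := ⟨_, rfl⟩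
  rw [← hIdef] at hI
  refine ⟨I, hI, fun {v x} hv hx => ?_⟩
  have hdec : Tendsto (fun z : Euc n => ‖z‖ ^ Module.finrank ℝ (Euc n) * (I⁻¹ * ψ z))
      (Bornology.cobounded (Euc n)) (𝓝 0) := by
    have h1 : Tendsto (fun z : Euc n => I⁻¹ * (‖z‖ ^ 2)⁻¹) (Bornology.cobounded (Euc n)) (𝓝 0) := by
      have := ((tendsto_pow_atTop (two_ne_zero)).comp
        (tendsto_norm_cobounded_atTop (E := Euc n))).inv_tendsto_atTop.const_mul I⁻¹
      simpa using this
    refine squeeze_zero' (Eventually.of_forall fun z => ?_) ?_ h1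
    · have := (hψ0 z).le; positivity
    · filter_upwards [(tendsto_norm_cobounded_atTop (E := Euc n)).eventually_gt_atTop 0] with z hz
      have h2 : ψ z ≤ (‖z‖ ^ (n + 2))⁻¹ := by
        have : ψ z ≤ (‖z‖ ^ 2) ^ (-((n : ℝ) + 2) / 2) := by
          rw [hψ]
          exact Real.rpow_le_rpow_of_nonpos (by positivity) (by linarith)
            (by have : (0 : ℝ) ≤ n := by positivity
                linarith)
        refine this.trans_eq ?_
        rw [← Real.rpow_natCast ‖z‖ 2, ← Real.rpow_mul (norm_nonneg _), ← Real.rpow_natCast,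
          ← Real.rpow_neg (norm_nonneg _)]
        congr 1; push_cast; ring
      rw [finrank_euclideanSpace_fin]
      calc ‖z‖ ^ n * (I⁻¹ * ψ z) ≤ ‖z‖ ^ n * (I⁻¹ * (‖z‖ ^ (n + 2))⁻¹) := by gcongr
        _ = I⁻¹ * (‖z‖ ^ 2)⁻¹ := by
          rw [pow_add, mul_inv]
          have : ‖z‖ ^ n ≠ 0 := by positivity
          rw [mul_left_comm, ← mul_assoc (‖z‖ ^ n), mul_inv_cancel₀ this, one_mul]
  have h := tendsto_integral_comp_smul_smul_of_integrable' (μ := (volume : Measure (Euc n)))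
    (φ := fun z => I⁻¹ * ψ z) (fun z => by have := (hψ0 z).le; positivity)
    (by rw [integral_const_mul, ← hIdef]; exact inv_mul_cancel₀ hI.ne') hdec hv hx
  refine (h.const_mul I).congr' ?_
  filter_upwards [eventually_gt_atTop (0 : ℝ)] with c hc
  rw [← integral_const_mul]
  congr 1; ext y
  rw [finrank_euclideanSpace_fin, smul_eq_mul]
  have e : ψ (c • (x - y)) =
      (c ^ 2) ^ (-((n : ℝ) + 2) / 2) * (‖x - y‖ ^ 2 + (c⁻¹) ^ 2) ^ (-((n : ℝ) + 2) / 2) := by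
    rw [← Real.mul_rpow (by positivity) (by positivity)]
    simp only [hψ]
    congr 1
    rw [norm_smul, Real.norm_of_nonneg hc.le]
    field_simp
    ring
  have e2 : (c ^ 2) ^ (-((n : ℝ) + 2) / 2) = (c ^ (n + 2))⁻¹ := by
    rw [← Real.rpow_natCast c 2, ← Real.rpow_mul hc.le, ← Real.rpow_natCast,
      ← Real.rpow_neg hc.le]
    congr 1; push_cast; ring
  rw [e, e2, pow_add]
  field_simp

theorem exists_mul_eq_integral_riesz (hn : 3 ≤ n) {lam : ℝ}
    (hlam : (n : ℝ) / ((n : ℝ) - 2) ≤ lam) : ∃ c : ℝ, 0 < c ∧ ∀ {v : Euc n → ℝ},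
    ContDiffOn ℝ 2 v {0}ᶜ → HasCompactSupport v → (∀ x, 0 ≤ v x) → Integrable v →
    ∫⁻ x, ENNReal.ofReal (v x) ^ lam < ∞ → Integrable (lap v) →
    ∀ x, x ≠ 0 → Integrable (fun y => ‖x - y‖ ^ (-((n : ℝ) - 2)) * -lap v y) ∧
      c * v x = ∫ y, ‖x - y‖ ^ (-((n : ℝ) - 2)) * -lap v y := by
  obtain ⟨I, hI, hpeak⟩ := exists_tendsto_integral_peak hn
  have hn3 : (3 : ℝ) ≤ n := by exact_mod_cast hn
  have hn2 : 0 < (n : ℝ) - 2 := by linarith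
  refine ⟨((n : ℝ) - 2) * n * I, by positivity, fun {v} hv hvc hv0 hvi hvl hl x hx => ?_⟩
  have hlc : ContinuousOn (lap v) {0}ᶜ := continuousOn_lap isOpen_compl_singleton hv
  have hvx : ContinuousAt v x := hv.continuousOn.continuousAt (isOpen_compl_singleton.mem_nhds hx)
  have hlx : ContinuousAt (lap v) x := hlc.continuousAt (isOpen_compl_singleton.mem_nhds hx)
  have hnear : ∃ r M : ℝ, 0 < r ∧ ∀ y ∈ ball x r, |(-lap v y)| ≤ M := by
    have hla : ContinuousAt (fun y => |(-lap v y)|) x := hlx.neg.abs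
    have : ∀ᶠ y in 𝓝 x, |(-lap v y)| < |(-lap v x)| + 1 :=
      hla.eventually_lt continuousAt_const (by linarith)
    obtain ⟨r, hr, h⟩ := Metric.eventually_nhds_iff_ball.1 this
    exact ⟨r, _, hr, fun y hy => (h y hy).le⟩
  obtain ⟨r, M, hr, hM⟩ := hnear
  have hint : Integrable fun y => ‖x - y‖ ^ (-((n : ℝ) - 2)) * -lap v y :=
    integrable_riesz_mul (by omega) hn2.le (by linarith) hl.neg hr hM
  refine ⟨hint, ?_⟩
  have h1 := (hpeak hvi hvx).const_mul (((n : ℝ) - 2) * n)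
  have h2 := tendsto_integral_norm_sq_add_rpow_mul hn hn2.le hl.neg.1 hint
    tendsto_inv_atTop_zero
  rw [mul_assoc]
  refine tendsto_nhds_unique (h1.congr' ?_) h2
  filter_upwards [eventually_gt_atTop (0 : ℝ)] with c hc
  have hc' : 0 < c⁻¹ := inv_pos.2 hc
  have h3 := integral_mul_lap_of_integrable hn hlam hv hvc hv0 hvi hvl
    (contDiff_norm_sub_sq_add_rpow (k := 2) hc' (-((n : ℝ) - 2) / 2) x) hl
  simp_rw [lap_norm_sub_sq_add_rpow hc', norm_sub_rev _ x] at h3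
  rw [← integral_const_mul]
  have h4 : ∫ y, (‖x - y‖ ^ 2 + c⁻¹ ^ 2) ^ (-((n : ℝ) - 2) / 2) * -lap v y =
      -∫ y, (‖x - y‖ ^ 2 + c⁻¹ ^ 2) ^ (-((n : ℝ) - 2) / 2) * lap v y := by
    rw [← integral_neg]; simp
  simp only [Pi.neg_apply]
  rw [h4, h3, ← integral_neg]
  congr 1; ext y; ring

end RegularizedKernel

section Potential

variable {n : ℕ}

/-- The gradient of the regularized Riesz kernel `(‖z‖² + δ²) ^ (-γ / 2)`. -/
noncomputable def rieszGrad (γ δ : ℝ) (z : Euc n) : Euc n →L[ℝ] ℝ :=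
  (-γ * (‖z‖ ^ 2 + δ ^ 2) ^ (-(γ + 2) / 2)) • innerSL ℝ z

theorem norm_rieszGrad_le {γ : ℝ} (hγ : 0 ≤ γ) (δ : ℝ) (z : Euc n) :
    ‖rieszGrad γ δ z‖ ≤ γ * (‖z‖ ^ 2 + δ ^ 2) ^ (-(γ + 1) / 2) := by
  rw [rieszGrad, norm_smul, innerSL_apply_norm, norm_mul, norm_neg, Real.norm_of_nonneg hγ,
    Real.norm_of_nonneg (by positivity), mul_assoc]
  refine mul_le_mul_of_nonneg_left ?_ hγ
  by_cases hz : z = 0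
  · rw [hz, norm_zero, mul_zero]; positivity
  have hz' : 0 < ‖z‖ := norm_pos_iff.2 hz
  have hQ : 0 < ‖z‖ ^ 2 + δ ^ 2 := by positivity
  have h1 : ‖z‖ ≤ (‖z‖ ^ 2 + δ ^ 2) ^ (1 / 2 : ℝ) := by
    rw [← Real.sqrt_eq_rpow]
    exact Real.le_sqrt_of_sq_le (by nlinarith [sq_nonneg δ])
  calc (‖z‖ ^ 2 + δ ^ 2) ^ (-(γ + 2) / 2) * ‖z‖
      ≤ (‖z‖ ^ 2 + δ ^ 2) ^ (-(γ + 2) / 2) * (‖z‖ ^ 2 + δ ^ 2) ^ (1 / 2 : ℝ) := by gcongr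
    _ = _ := by rw [← Real.rpow_add hQ]; congr 1; ring

theorem aestronglyMeasurable_rieszGrad (γ δ : ℝ) :
    AEStronglyMeasurable (fun z : Euc n => rieszGrad γ δ z) := by
  have h : Measurable fun z : Euc n => -γ * (‖z‖ ^ 2 + δ ^ 2) ^ (-(γ + 2) / 2) := by fun_prop
  exact h.aestronglyMeasurable.smul
    (innerSL ℝ : Euc n →L[ℝ] Euc n →L[ℝ] ℝ).continuous.aestronglyMeasurable

theorem aestronglyMeasurable_rieszGrad_sub (γ δ : ℝ) (x : Euc n) :
    AEStronglyMeasurable (fun y : Euc n => rieszGrad γ δ (x - y)) := by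
  have h : Measurable fun y : Euc n => -γ * (‖x - y‖ ^ 2 + δ ^ 2) ^ (-(γ + 2) / 2) := by
    fun_prop
  exact h.aestronglyMeasurable.smul
    ((innerSL ℝ : Euc n →L[ℝ] Euc n →L[ℝ] ℝ).continuous.comp
      (continuous_const.sub continuous_id)).aestronglyMeasurable

theorem continuous_rieszGrad (γ : ℝ) {δ : ℝ} (hδ : 0 < δ) :
    Continuous (rieszGrad γ δ : Euc n → _) := by
  have h : Continuous fun z : Euc n => (‖z‖ ^ 2 + δ ^ 2) ^ (-(γ + 2) / 2) := by
    refine Continuous.rpow_const (by fun_prop) fun z => Or.inl ?_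
    positivity
  exact (continuous_const.mul h).smul (innerSL ℝ : Euc n →L[ℝ] Euc n →L[ℝ] ℝ).continuous

theorem tendsto_rieszGrad (γ : ℝ) {z : Euc n} (hz : z ≠ 0) {ι : Type*} {l : Filter ι}
    {δ : ι → ℝ} (hδ : Tendsto δ l (𝓝 0)) :
    Tendsto (fun i => rieszGrad γ (δ i) z) l (𝓝 (rieszGrad γ 0 z)) := by
  have hz' : 0 < ‖z‖ := norm_pos_iff.2 hz
  refine Tendsto.smul_const (Tendsto.const_mul _ ?_) _
  refine Tendsto.rpow_const ((hδ.pow 2).const_add _) (Or.inl ?_)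
  positivity

theorem tendsto_integral_norm_rieszGrad_sub (hn : 3 ≤ n) {γ : ℝ} (hγ0 : 0 ≤ γ) (hγ : γ + 1 < n)
    (R : ℝ) {ι : Type*} {l : Filter ι} [l.IsCountablyGenerated] {δ : ι → ℝ}
    (hδ : Tendsto δ l (𝓝 0)) :
    (∀ δ, Integrable ((ball (0 : Euc n) R).indicator
      fun z => ‖rieszGrad γ 0 z - rieszGrad γ δ z‖)) ∧
    Tendsto (fun i => ∫ z, (ball (0 : Euc n) R).indicator
      (fun z => ‖rieszGrad γ 0 z - rieszGrad γ (δ i) z‖) z) l (𝓝 0) := by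
  have hn0 : 0 < n := by omega
  have hm : ∀ δ, AEStronglyMeasurable ((ball (0 : Euc n) R).indicator
      fun z => ‖rieszGrad γ 0 z - rieszGrad γ δ z‖) := fun δ =>
    ((aestronglyMeasurable_rieszGrad γ 0).sub (aestronglyMeasurable_rieszGrad γ δ)).norm.indicator
      measurableSet_ball
  have hb : Integrable fun z => 2 * γ *
      (ball (0 : Euc n) R).indicator (fun y => ‖(0 : Euc n) - y‖ ^ (-(γ + 1))) z :=
    (integrable_indicator_riesz hn0 hγ (0 : Euc n) R).const_mul _
  have hle : ∀ δ, ∀ᵐ z : Euc n, ‖(ball (0 : Euc n) R).indicator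
      (fun z => ‖rieszGrad γ 0 z - rieszGrad γ δ z‖) z‖ ≤ 2 * γ *
      (ball (0 : Euc n) R).indicator (fun y => ‖(0 : Euc n) - y‖ ^ (-(γ + 1))) z := by
    intro δ
    filter_upwards [ae_ne_zero hn] with z hz
    by_cases hzR : z ∈ ball (0 : Euc n) R
    · rw [indicator_of_mem hzR, indicator_of_mem hzR, norm_norm, zero_sub, norm_neg]
      have h1 := (norm_rieszGrad_le hγ0 0 z).trans
        (mul_le_mul_of_nonneg_left (norm_sq_add_rpow_le (γ := γ + 1) (by linarith) 0 hz) hγ0)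
      have h2 := (norm_rieszGrad_le hγ0 δ z).trans
        (mul_le_mul_of_nonneg_left (norm_sq_add_rpow_le (γ := γ + 1) (by linarith) δ hz) hγ0)
      linarith [norm_sub_le (rieszGrad γ 0 z) (rieszGrad γ δ z)]
    · rw [indicator_of_notMem hzR, indicator_of_notMem hzR]; simp
  refine ⟨fun δ => hb.mono' (hm δ) (hle δ), ?_⟩
  have h := tendsto_integral_filter_of_dominated_convergence (l := l)
    (F := fun i z => (ball (0 : Euc n) R).indicator
      (fun z => ‖rieszGrad γ 0 z - rieszGrad γ (δ i) z‖) z) (f := fun _ => 0) _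
    (Eventually.of_forall fun i => hm (δ i)) (Eventually.of_forall fun i => hle (δ i)) hb ?_
  · simpa using h
  filter_upwards [ae_ne_zero hn] with z hz
  by_cases hzR : z ∈ ball (0 : Euc n) R
  · simp only [indicator_of_mem hzR]
    have := ((tendsto_rieszGrad γ hz hδ).const_sub (rieszGrad γ 0 z)).norm
    simpa using this
  · simp only [indicator_of_notMem hzR]
    exact tendsto_const_nhds

/-- The Riesz potential of order at most `n - 1` of a bounded function with bounded support
is continuously differentiable. -/
theorem contDiff_one_integral_riesz_mul (hn : 3 ≤ n) {γ : ℝ} (hγ0 : 0 ≤ γ) (hγ : γ + 1 < n)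
    {g : Euc n → ℝ} (hg : AEStronglyMeasurable g) {M ρ : ℝ} (hM : ∀ y, |g y| ≤ M)
    (hρ : ∀ y, ρ ≤ ‖y‖ → g y = 0) :
    ContDiff ℝ 1 fun x => ∫ y, ‖x - y‖ ^ (-γ) * g y := by
  have hn0 : 0 < n := by omega
  have hM0 : 0 ≤ M := (abs_nonneg _).trans (hM 0)
  have hgi : Integrable g := by
    have : Integrable ((ball (0 : Euc n) ρ).indicator fun _ => M) := by
      rw [integrable_indicator_iff measurableSet_ball]
      exact integrableOn_const measure_ball_lt_top.ne
    refine this.mono' hg (ae_of_all _ fun y => ?_)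
    by_cases hy : y ∈ ball (0 : Euc n) ρ
    · rw [indicator_of_mem hy]; exact hM y
    · rw [indicator_of_notMem hy, hρ y (by simpa using hy), norm_zero]
  have hint : ∀ x, Integrable fun y => ‖x - y‖ ^ (-γ) * g y := fun x =>
    integrable_riesz_mul hn0 hγ0 (by linarith) hgi one_pos fun y _ => hM y
  have hbound : ∀ {δ : ℝ}, 0 < δ → ∀ x y : Euc n,
      ‖g y • rieszGrad γ δ (x - y)‖ ≤ γ * (δ ^ 2) ^ (-(γ + 1) / 2) * ‖g y‖ := by
    intro δ hδ x y
    rw [norm_smul, mul_comm]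
    refine mul_le_mul_of_nonneg_right ((norm_rieszGrad_le hγ0 δ _).trans ?_) (norm_nonneg _)
    exact mul_le_mul_of_nonneg_left (Real.rpow_le_rpow_of_nonpos (by positivity)
      (le_add_of_nonneg_left (by positivity)) (by linarith)) hγ0
  have hmeas : ∀ δ x, AEStronglyMeasurable fun y => g y • rieszGrad γ δ (x - y) := fun δ x =>
    hg.smul (aestronglyMeasurable_rieszGrad_sub γ δ x)
  have hderiv : ∀ {δ : ℝ}, 0 < δ → ∀ x, HasFDerivAt
      (fun x => ∫ y, (‖x - y‖ ^ 2 + δ ^ 2) ^ (-γ / 2) * g y)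
      (∫ y, g y • rieszGrad γ δ (x - y)) x := by
    intro δ hδ x
    refine hasFDerivAt_integral_of_dominated_of_fderiv_le
      (F := fun x y => (‖x - y‖ ^ 2 + δ ^ 2) ^ (-γ / 2) * g y)
      (F' := fun x y => g y • rieszGrad γ δ (x - y)) univ_mem
      (Eventually.of_forall fun x' => ?_) ?_ (hmeas δ x)
      (ae_of_all _ fun y x' _ => hbound hδ x' y) (hgi.norm.const_mul _)
      (ae_of_all _ fun y x' _ => ?_)
    · exact AEStronglyMeasurable.mul (Measurable.aestronglyMeasurable (by fun_prop)) hg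
    · refine hgi.bdd_mul (c := (δ ^ 2) ^ (-γ / 2))
        (Measurable.aestronglyMeasurable (by fun_prop)) (ae_of_all _ fun y => ?_)
      rw [Real.norm_of_nonneg (by positivity)]
      exact Real.rpow_le_rpow_of_nonpos (by positivity)
        (le_add_of_nonneg_left (by positivity)) (by linarith)
    · refine ((hasFDerivAt_norm_sub_sq_add_rpow hδ (-γ / 2) y x').mul_const (g y)).congr_fderiv ?_
      rw [rieszGrad]
      congr 2
      have e : -γ / 2 - 1 = -(γ + 2) / 2 := by ring
      rw [e]; ring
  have hcont : ∀ {δ : ℝ}, 0 < δ → Continuous fun x => ∫ y, g y • rieszGrad γ δ (x - y) :=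
    fun {δ} hδ => continuous_of_dominated (hmeas δ) (fun x => ae_of_all _ fun y => hbound hδ x y)
      (hgi.norm.const_mul _) (ae_of_all _ fun y => Continuous.const_smul
        ((continuous_rieszGrad γ hδ).comp (continuous_sub_right y)) (g y))
  set δ : ℕ → ℝ := fun m => 1 / ((m : ℝ) + 1) with hδdef
  have hδ : ∀ m, 0 < δ m := fun m => by simp only [hδdef]; positivity
  have hδt : Tendsto δ atTop (𝓝 0) := tendsto_one_div_add_atTop_nhds_zero_nat
  have hint0 : ∀ x, Integrable fun y => g y • rieszGrad γ 0 (x - y) := by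
    intro x
    have h := ((integrable_riesz_mul hn0 (by linarith : 0 ≤ γ + 1) hγ hgi one_pos
      (x := x) fun y _ => hM y).norm).const_mul γ
    have : Nonempty (Fin n) := ⟨⟨0, hn0⟩⟩
    have : Nontrivial (Euc n) := inferInstance
    refine h.mono' (hmeas 0 x) ?_
    filter_upwards [Measure.ae_ne volume x] with y hy
    rw [norm_smul, norm_mul, Real.norm_of_nonneg (show 0 ≤ ‖x - y‖ ^ (-(γ + 1)) by positivity),
      ← mul_assoc, mul_comm ‖g y‖]
    exact mul_le_mul_of_nonneg_right ((norm_rieszGrad_le hγ0 0 _).trans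
      (mul_le_mul_of_nonneg_left (norm_sq_add_rpow_le (by linarith) 0 (sub_ne_zero.2 hy.symm)) hγ0))
      (norm_nonneg _)
  have hintδ : ∀ {δ : ℝ}, 0 < δ → ∀ x, Integrable fun y => g y • rieszGrad γ δ (x - y) :=
    fun {δ} hδ x => (hgi.norm.const_mul _).mono' (hmeas δ x) (ae_of_all _ fun y => hbound hδ x y)
  have hunif : ∀ R : ℝ, TendstoUniformlyOn (fun m x => ∫ y, g y • rieszGrad γ (δ m) (x - y))
      (fun x => ∫ y, g y • rieszGrad γ 0 (x - y)) atTop (ball 0 R) := by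
    intro R
    obtain ⟨hE, hEt⟩ := tendsto_integral_norm_rieszGrad_sub hn hγ0 hγ (R + ρ) hδt
    rw [Metric.tendstoUniformlyOn_iff]
    intro ε hε
    have hEt' := hEt.const_mul M
    rw [mul_zero] at hEt'
    filter_upwards [(tendsto_order.1 hEt').2 ε hε] with m hm x hx
    refine lt_of_le_of_lt ?_ hm
    rw [dist_eq_norm, ← integral_sub (hint0 x) (hintδ (hδ m) x),
      ← integral_sub_left_eq_self ((ball (0 : Euc n) (R + ρ)).indicator fun z =>
        ‖rieszGrad γ 0 z - rieszGrad γ (δ m) z‖) volume x, ← integral_const_mul]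
    refine norm_integral_le_of_norm_le (((hE (δ m)).comp_sub_left x).const_mul M)
      (ae_of_all _ fun y => ?_)
    rw [← smul_sub (g y) (rieszGrad γ 0 (x - y)) (rieszGrad γ (δ m) (x - y)), norm_smul]
    by_cases hy : ‖y‖ < ρ
    · have hxy : x - y ∈ ball (0 : Euc n) (R + ρ) := by
        have hx' : ‖x‖ < R := by simpa using hx
        simpa using (norm_sub_le x y).trans_lt (by linarith)
      rw [indicator_of_mem hxy]
      exact mul_le_mul_of_nonneg_right (hM y) (norm_nonneg _)
    · rw [hρ y (not_lt.1 hy), norm_zero, zero_mul]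
      exact mul_nonneg hM0 (indicator_nonneg (fun _ _ => norm_nonneg _) _)
  rw [contDiff_one_iff_hasFDerivAt]
  refine ⟨fun x => ∫ y, g y • rieszGrad γ 0 (x - y), ?_, fun x => ?_⟩
  · rw [continuous_iff_continuousAt]
    intro x
    have hx : x ∈ ball (0 : Euc n) (‖x‖ + 1) := by simp
    exact ((hunif (‖x‖ + 1)).continuousOn
      (Frequently.of_forall fun m => (hcont (hδ m)).continuousOn)).continuousAt
      (isOpen_ball.mem_nhds hx)
  · have hx : x ∈ ball (0 : Euc n) (‖x‖ + 1) := by simp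
    exact hasFDerivAt_of_tendstoUniformlyOn isOpen_ball (hunif (‖x‖ + 1))
      (fun m x _ => hderiv (hδ m) x)
      (fun x _ => tendsto_integral_norm_sq_add_rpow_mul hn hγ0 hg (hint x) hδt) hx

end Potential

section Main

variable {n : ℕ}

theorem exists_lintegral_riesz_le_add (hn : 0 < n) {γ : ℝ} (hγ0 : 0 ≤ γ) (hγ : γ < n)
    {f : Euc n → ℝ≥0∞} (hf : Measurable f) (hfi : ∫⁻ y, f y < ∞) {A : ℝ≥0∞} (hA : A ≠ ∞)
    (hfA : ∀ y ∈ ball (0 : Euc n) 1 \ ball 0 (1 / 2), f y ≤ A) :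
    ∃ D : ℝ≥0∞, D ≠ ∞ ∧ ∀ x ∈ ball (0 : Euc n) (1 / 2),
      ∫⁻ y, ENNReal.ofReal (‖x - y‖ ^ (-γ)) * f y ≤
        D + ∫⁻ y in ball (0 : Euc n) (1 / 2), ENNReal.ofReal (‖x - y‖ ^ (-γ)) * f y := by
  obtain ⟨K, hK, hK'⟩ := exists_lintegral_riesz_le hn hγ0 hγ 1
  refine ⟨A * K + ENNReal.ofReal ((1 / 2) ^ (-γ)) * ∫⁻ y, f y, ?_, fun x hx => ?_⟩
  · exact ENNReal.add_ne_top.2 ⟨ENNReal.mul_ne_top hA hK,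
      ENNReal.mul_ne_top ENNReal.ofReal_ne_top hfi.ne⟩
  rw [← lintegral_add_compl _ (measurableSet_ball (x := (0 : Euc n)) (ε := 1 / 2)), add_comm]
  gcongr
  have hk : Measurable fun y => ENNReal.ofReal (‖x - y‖ ^ (-γ)) := by fun_prop
  calc ∫⁻ y in (ball (0 : Euc n) (1 / 2))ᶜ, ENNReal.ofReal (‖x - y‖ ^ (-γ)) * f y
      ≤ ∫⁻ y in (ball (0 : Euc n) (1 / 2))ᶜ,
          ((ball (0 : Euc n) 1).indicator (fun y => A * ENNReal.ofReal (‖x - y‖ ^ (-γ))) y +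
            ENNReal.ofReal ((1 / 2) ^ (-γ)) * f y) := by
        refine setLIntegral_mono' measurableSet_ball.compl fun y hy => ?_
        by_cases hy1 : y ∈ ball (0 : Euc n) 1
        · rw [indicator_of_mem hy1, mul_comm]
          exact le_add_right (mul_le_mul_left (hfA y ⟨hy1, hy⟩) _)
        · refine le_add_left (mul_le_mul_left (ENNReal.ofReal_le_ofReal ?_) _)
          refine Real.rpow_le_rpow_of_nonpos (by norm_num) ?_ (by linarith)
          have h1 : 1 ≤ ‖y‖ := by simpa using hy1
          have h2 : ‖x‖ < 1 / 2 := by simpa using hx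
          have h3 := norm_sub_norm_le y x
          rw [norm_sub_rev] at h3
          linarith
    _ ≤ ∫⁻ y, ((ball (0 : Euc n) 1).indicator
          (fun y => A * ENNReal.ofReal (‖x - y‖ ^ (-γ))) y +
            ENNReal.ofReal ((1 / 2) ^ (-γ)) * f y) := setLIntegral_le_lintegral _ _
    _ ≤ _ := by
        rw [lintegral_add_right _ (hf.const_mul _), lintegral_const_mul _ hf,
          lintegral_indicator measurableSet_ball, lintegral_const_mul _ hk]
        gcongr
        exact hK' x

theorem exists_norm_le_annulus {f : Euc n → ℝ} (hf : ContinuousOn f {0}ᶜ) {r : ℝ} (hr : 0 < r)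
    (R : ℝ) : ∃ A, ∀ y ∈ closedBall (0 : Euc n) R \ ball 0 r, ‖f y‖ ≤ A := by
  refine ((isCompact_closedBall _ _).diff isOpen_ball).exists_bound_of_continuousOn
    (hf.mono fun x hx h0 => hx.2 ?_)
  rw [mem_singleton_iff.1 h0]
  exact mem_ball_self hr

theorem IsCPSolution.lintegral_lt_top {α lam sig : ℝ} {u : Euc n → ℝ}
    (hu : IsCPSolution n α lam sig u) (hlam : 0 ≤ lam) :
    ∫⁻ x, ENNReal.ofReal (u x) ^ lam < ∞ := by
  have h := (hasFiniteIntegral_iff_ofReal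
    (ae_of_all _ fun x => Real.rpow_nonneg (hu.1 x) lam)).1 hu.2.2.1.2
  refine lt_of_eq_of_lt (lintegral_congr fun x => ?_) h
  exact ENNReal.ofReal_rpow_of_nonneg (hu.1 x) hlam

theorem IsCPSolution.exists_eq_integral_riesz {α lam sig : ℝ} {u : Euc n → ℝ}
    (hu : IsCPSolution n α lam sig u) (hn : 3 ≤ n) (hlam : (n : ℝ) / ((n : ℝ) - 2) ≤ lam) :
    ∃ c : ℝ, 0 < c ∧ ∃ g : Euc n → ℝ, ContinuousOn g {0}ᶜ ∧ HasCompactSupport g ∧ Integrable g ∧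
      (∀ x ∈ ball (0 : Euc n) 1, g x = -lap u x) ∧
      ∀ x ∈ ball (0 : Euc n) 1, x ≠ 0 → c * u x = ∫ y, ‖x - y‖ ^ (-((n : ℝ) - 2)) * g y := by
  have hn3 : (3 : ℝ) ≤ n := by exact_mod_cast hn
  have hlam1 : 1 ≤ lam := le_trans (by rw [le_div_iff₀ (by linarith)]; linarith) hlam
  obtain ⟨c, hc, hrep⟩ := exists_mul_eq_integral_riesz hn hlam
  have hul := hu.lintegral_lt_top (by linarith)
  obtain ⟨hu0, hu2, hui, hineq⟩ := hu
  let χ : ContDiffBump (0 : Euc n) := ⟨1, 3 / 2, by norm_num, by norm_num⟩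
  set v : Euc n → ℝ := fun x => χ x * u x with hvdef
  have hv2 : ContDiffOn ℝ 2 v {0}ᶜ := (χ.contDiff (n := 2)).contDiffOn.mul hu2
  have hvc : HasCompactSupport v := χ.hasCompactSupport.mul_right
  have hv0 : ∀ x, 0 ≤ v x := fun x => mul_nonneg χ.nonneg (hu0 x)
  have hvu : ∀ x, v x ≤ u x := fun x => mul_le_of_le_one_left (hu0 x) χ.le_one
  have hvm : Measurable v := measurable_of_continuousOn_compl_singleton 0 hv2.continuousOn
  have hvl : ∫⁻ x, ENNReal.ofReal (v x) ^ lam < ∞ := by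
    refine lt_of_le_of_lt (lintegral_mono fun x => ?_) hul
    exact ENNReal.rpow_le_rpow (ENNReal.ofReal_le_ofReal (hvu x)) (by linarith)
  have hvi : Integrable v := by
    have h1 : Integrable ((ball (0 : Euc n) (3 / 2)).indicator fun _ => (1 : ℝ)) := by
      rw [integrable_indicator_iff measurableSet_ball]
      exact integrableOn_const measure_ball_lt_top.ne
    refine (h1.add hui).mono' hvm.aestronglyMeasurable (ae_of_all _ fun x => ?_)
    have hp : 0 ≤ u x ^ lam := Real.rpow_nonneg (hu0 x) _
    rw [Pi.add_apply, Real.norm_of_nonneg (hv0 x)]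
    by_cases hx : x ∈ ball (0 : Euc n) (3 / 2)
    · rw [indicator_of_mem hx]
      refine (hvu x).trans ?_
      rcases le_total (u x) 1 with h | h
      · linarith
      · have := Real.self_le_rpow_of_one_le h hlam1
        linarith
    · have : v x = 0 := by
        simp only [hvdef]
        rw [χ.zero_of_le_dist (by simpa using hx), zero_mul]
      rw [indicator_of_notMem hx, this]
      linarith
  have hveq : ∀ x ∈ ball (0 : Euc n) 1, v x = u x := fun x hx => by
    simp only [hvdef]
    rw [χ.one_of_mem_closedBall (ball_subset_closedBall hx), one_mul]
  have hlap : ∀ x ∈ ball (0 : Euc n) 1, lap v x = lap u x := fun x hx =>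
    lap_congr (by filter_upwards [isOpen_ball.mem_nhds hx] with y hy using hveq y hy)
  have hl : Integrable (lap v) := by
    refine integrable_lap hn hlam hv2 hvc hv0 hvi hvl one_pos fun x hx => ?_
    rw [hlap x hx.1]
    exact (hineq x ⟨ball_subset_ball (by norm_num) hx.1, hx.2⟩).1
  refine ⟨c, hc, fun x => -lap v x, (continuousOn_lap isOpen_compl_singleton hv2).neg,
    (hasCompactSupport_lap hvc).neg, hl.neg, fun x hx => by simp only [hlap x hx], fun x hx hx0 => ?_⟩
  rw [← hveq x hx]
  exact (hrep hv2 hvc hv0 hvi hvl hl x hx0).2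

theorem IsCPSolution.exists_le_near_zero {α lam sig : ℝ} {u : Euc n → ℝ}
    (hu : IsCPSolution n α lam sig u) (hn : 3 ≤ n) (hα0 : 0 < α) (hαn : α < n)
    (hlam : (n : ℝ) / ((n : ℝ) - 2) ≤ lam) (hsig0 : 0 ≤ sig)
    (hsig1 : sig < 1 - (α - 2) / (n : ℝ) * lam) {c : ℝ} (hc : 0 < c) {g : Euc n → ℝ}
    (hgc : ContinuousOn g {0}ᶜ) (hgi : Integrable g)
    (hg : ∀ x ∈ ball (0 : Euc n) 1, g x = -lap u x)
    (hrep : ∀ x ∈ ball (0 : Euc n) 1, x ≠ 0 →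
      c * u x = ∫ y, ‖x - y‖ ^ (-((n : ℝ) - 2)) * g y) :
    ∃ M, ∀ x ∈ ball (0 : Euc n) (1 / 2), x ≠ 0 → u x ≤ M ∧ |g x| ≤ M := by
  have hn0 : 0 < n := by omega
  have hn3 : (3 : ℝ) ≤ n := by exact_mod_cast hn
  have hlam1 : 1 ≤ lam := le_trans (by rw [le_div_iff₀ (by linarith)]; linarith) hlam
  have hlam0 : 0 ≤ lam := by linarith
  have hul := hu.lintegral_lt_top hlam0
  obtain ⟨hu0, hu2, hui, hineq⟩ := hu
  have huc : ContinuousOn u {0}ᶜ := hu2.continuousOn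
  have hum : Measurable u := measurable_of_continuousOn_compl_singleton 0 huc
  have hgm : Measurable g := measurable_of_continuousOn_compl_singleton 0 hgc
  set F : Euc n → ℝ≥0∞ := fun x => ENNReal.ofReal (u x) with hF
  have hFm : Measurable F := hum.ennreal_ofReal
  obtain ⟨A, hA⟩ := exists_norm_le_annulus huc (r := 1 / 2) (by norm_num) 1
  obtain ⟨D, hD, hDle⟩ := exists_lintegral_riesz_le_add hn0 hα0.le hαn (hFm.pow_const lam) hul
    (A := ENNReal.ofReal A ^ lam) (ENNReal.rpow_ne_top_of_nonneg hlam0 ENNReal.ofReal_ne_top)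
    (fun y hy => ENNReal.rpow_le_rpow (ENNReal.ofReal_le_ofReal ((le_abs_self _).trans
      (hA y ⟨ball_subset_closedBall hy.1, hy.2⟩))) hlam0)
  obtain ⟨A', hA'⟩ := exists_norm_le_annulus hgc (r := 1 / 2) (by norm_num) 1
  obtain ⟨D', hD', hDle'⟩ := exists_lintegral_riesz_le_add hn0 (γ := (n : ℝ) - 2)
    (by linarith) (by linarith) hgm.enorm hgi.2
    (A := ENNReal.ofReal A') ENNReal.ofReal_ne_top
    (fun y hy => by
      rw [← ofReal_norm]
      exact ENNReal.ofReal_le_ofReal (hA' y ⟨ball_subset_closedBall hy.1, hy.2⟩))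
  set N : Euc n → ℝ≥0∞ := fun y =>
    ∫⁻ z in ball (0 : Euc n) (1 / 2), ENNReal.ofReal (‖y - z‖ ^ (-α)) * F z ^ lam with hN
  have hB1 : ball (0 : Euc n) (1 / 2) ⊆ ball 0 1 := ball_subset_ball (by norm_num)
  have hB2 : ball (0 : Euc n) (1 / 2) ⊆ ball 0 2 := ball_subset_ball (by norm_num)
  have hnonlocal : ∀ x ∈ ball (0 : Euc n) (1 / 2),
      ENNReal.ofReal (∫ y, ‖x - y‖ ^ (-α) * u y ^ lam) ≤ D + N x := by
    intro x hx
    refine le_trans ?_ (hDle x hx)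
    rw [← Real.enorm_of_nonneg (integral_nonneg fun y =>
      mul_nonneg (by positivity) (Real.rpow_nonneg (hu0 y) _))]
    refine (enorm_integral_le_lintegral_enorm _).trans (lintegral_mono fun y => ?_)
    rw [enorm_mul, Real.enorm_of_nonneg (by positivity),
      Real.enorm_of_nonneg (Real.rpow_nonneg (hu0 y) _), hF,
      ENNReal.ofReal_rpow_of_nonneg (hu0 y) hlam0]
  have hgle : ∀ x ∈ ball (0 : Euc n) (1 / 2), x ≠ 0 → ‖g x‖ₑ ≤ (D + N x) * F x ^ sig := by
    intro x hx hx0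
    obtain ⟨h1, h2⟩ := hineq x ⟨hB2 hx, hx0⟩
    rw [hg x (hB1 hx), Real.enorm_of_nonneg h1]
    refine (ENNReal.ofReal_le_ofReal h2).trans ?_
    rw [ENNReal.ofReal_mul (integral_nonneg fun y =>
      mul_nonneg (by positivity) (Real.rpow_nonneg (hu0 y) _)), hF,
      ENNReal.ofReal_rpow_of_nonneg (hu0 x) hsig0]
    exact mul_le_mul_left (hnonlocal x hx) _
  have hFle : ∀ x ∈ ball (0 : Euc n) (1 / 2), x ≠ 0 → F x ≤ ENNReal.ofReal c⁻¹ *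
      (D' + ∫⁻ y in ball (0 : Euc n) (1 / 2),
        ENNReal.ofReal (‖x - y‖ ^ (-((n : ℝ) - 2))) * ‖g y‖ₑ) := by
    intro x hx hx0
    have h : u x = c⁻¹ * (c * u x) := by rw [inv_mul_cancel_left₀ hc.ne']
    rw [hF]
    beta_reduce
    rw [h, ENNReal.ofReal_mul (inv_nonneg.2 hc.le)]
    refine mul_le_mul_right (le_trans ?_ (hDle' x hx)) _
    rw [← Real.enorm_of_nonneg (mul_nonneg hc.le (hu0 x)), hrep x (hB1 hx) hx0]
    refine (enorm_integral_le_lintegral_enorm _).trans (lintegral_mono fun y => ?_)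
    rw [enorm_mul, Real.enorm_of_nonneg (by positivity)]
  set C : ℝ≥0∞ := 1 + D + ENNReal.ofReal c⁻¹ + ENNReal.ofReal c⁻¹ * D' with hC
  have hCt : C ≠ ∞ := by
    refine ENNReal.add_ne_top.2 ⟨ENNReal.add_ne_top.2 ⟨ENNReal.add_ne_top.2
      ⟨ENNReal.one_ne_top, hD⟩, ENNReal.ofReal_ne_top⟩, ENNReal.mul_ne_top ENNReal.ofReal_ne_top hD'⟩
  have hC1 : 1 ≤ C := by rw [hC, add_assoc, add_assoc]; exact le_self_add
  have hCD : D ≤ C := by rw [hC, add_comm 1 D, add_assoc, add_assoc]; exact le_self_add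
  have hCc : ENNReal.ofReal c⁻¹ ≤ C := by
    rw [hC, add_comm (1 + D), add_assoc]; exact le_self_add
  have hCD' : ENNReal.ofReal c⁻¹ * D' ≤ C := le_add_self
  have hae0 : ∀ᵐ x ∂(volume.restrict (ball (0 : Euc n) (1 / 2))),
      x ∈ ball (0 : Euc n) (1 / 2) ∧ x ≠ 0 := by
    filter_upwards [ae_restrict_mem measurableSet_ball, ae_restrict_of_ae (ae_ne_zero hn)] with x h1 h2
    exact ⟨h1, h2⟩
  obtain ⟨M, hM, hFM, hNM⟩ := riesz_bootstrap hn hα0 hαn hlam hsig0 hsig1 hCt hFm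
    (lt_of_le_of_lt (setLIntegral_le_lintegral (ball (0 : Euc n) (1 / 2)) _) hul) (by
      filter_upwards [hae0] with x hx
      refine (hFle x hx.1 hx.2).trans ?_
      rw [mul_add]
      refine add_le_add hCD' (mul_le_mul' hCc (lintegral_mono_ae ?_))
      filter_upwards [hae0] with y hy
      refine mul_le_mul_right ((hgle y hy.1 hy.2).trans (mul_le_mul_left ?_ _)) _
      exact add_le_add hCD (le_mul_of_one_le_left zero_le hC1))
  obtain ⟨K, hK, hKle⟩ := exists_lintegral_riesz_le hn0 (γ := (n : ℝ) - 2)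
    (by linarith) (by linarith) (1 / 2)
  set L : ℝ≥0∞ := ENNReal.ofReal c⁻¹ * (D' + K * ((D + M) * M ^ sig)) with hL
  have hLt : L ≠ ∞ := ENNReal.mul_ne_top ENNReal.ofReal_ne_top (ENNReal.add_ne_top.2 ⟨hD',
    ENNReal.mul_ne_top hK (ENNReal.mul_ne_top (ENNReal.add_ne_top.2 ⟨hD, hM⟩)
      (ENNReal.rpow_ne_top_of_nonneg hsig0 hM))⟩)
  have hFL : ∀ x ∈ ball (0 : Euc n) (1 / 2), x ≠ 0 → F x ≤ L := by
    intro x hx hx0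
    refine (hFle x hx hx0).trans (mul_le_mul_right (add_le_add le_rfl ?_) _)
    calc ∫⁻ y in ball (0 : Euc n) (1 / 2), ENNReal.ofReal (‖x - y‖ ^ (-((n : ℝ) - 2))) * ‖g y‖ₑ
        ≤ ∫⁻ y in ball (0 : Euc n) (1 / 2),
            ENNReal.ofReal (‖x - y‖ ^ (-((n : ℝ) - 2))) * ((D + M) * M ^ sig) := by
          refine lintegral_mono_ae ?_
          filter_upwards [hae0, hFM] with y hy hyM
          refine mul_le_mul_right ((hgle y hy.1 hy.2).trans (mul_le_mul' ?_ ?_)) _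
          · exact add_le_add le_rfl (hNM y)
          · exact ENNReal.rpow_le_rpow hyM hsig0
      _ ≤ _ := by
          rw [lintegral_mul_const _ (by fun_prop)]
          exact mul_le_mul_left (hKle x) _
  have hGt : (D + M) * L ^ sig ≠ ∞ := ENNReal.mul_ne_top (ENNReal.add_ne_top.2 ⟨hD, hM⟩)
    (ENNReal.rpow_ne_top_of_nonneg hsig0 hLt)
  refine ⟨max L.toReal ((D + M) * L ^ sig).toReal, fun x hx hx0 => ⟨?_, ?_⟩⟩
  · exact ((ENNReal.ofReal_le_iff_le_toReal hLt).1 (hFL x hx hx0)).trans (le_max_left _ _)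
  · refine le_trans ?_ (le_max_right _ _)
    rw [← Real.norm_eq_abs, ← toReal_enorm]
    refine ENNReal.toReal_mono hGt ((hgle x hx hx0).trans (mul_le_mul' ?_ ?_))
    · exact add_le_add le_rfl (hNM x)
    · exact ENNReal.rpow_le_rpow (hFL x hx hx0) hsig0

end Main

theorem stmt14 (n : ℕ) (hn : 3 ≤ n) (α lam sig : ℝ)
    (hα0 : 0 < α) (hαn : α < n)
    (hlam : (n : ℝ) / ((n : ℝ) - 2) ≤ lam)
    (hsig0 : 0 ≤ sig) (hsig1 : sig < 1 - (α - 2) / (n : ℝ) * lam)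
    (u : Euc n → ℝ) (hu : IsCPSolution n α lam sig u) :
    (u =O[𝓝[≠] (0 : Euc n)] fun _ => (1 : ℝ)) ∧
    ∃ w : Euc n → ℝ, ContDiff ℝ 1 w ∧ ∀ x : Euc n, x ≠ 0 → u x = w x := by
  have hn3 : (3 : ℝ) ≤ n := by exact_mod_cast hn
  obtain ⟨c, hc, g, hgc, hgs, hgi, hg, hrep⟩ := hu.exists_eq_integral_riesz hn hlam
  obtain ⟨M, hM⟩ := hu.exists_le_near_zero hn hα0 hαn hlam hsig0 hsig1 hc hgc hgi hg hrep
  refine ⟨IsBigO.of_bound M ?_, Function.update u 0 (c⁻¹ * ∫ y, ‖0 - y‖ ^ (-((n : ℝ) - 2)) * g y),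
    ?_, fun x hx => by rw [Function.update_of_ne hx]⟩
  · filter_upwards [self_mem_nhdsWithin, mem_nhdsWithin_of_mem_nhds
      (ball_mem_nhds (0 : Euc n) (show (0 : ℝ) < 1 / 2 by norm_num))] with x hx0 hx
    rw [norm_one, mul_one, Real.norm_of_nonneg (hu.1 x)]
    exact (hM x hx hx0).1
  obtain ⟨ρ, hρ⟩ := hgs.isCompact.isBounded.subset_ball 0
  obtain ⟨A, hA⟩ := exists_norm_le_annulus hgc (r := 1 / 2) (by norm_num) ρ
  have hbound : ∀ y, |g y| ≤ max (max M |g 0|) A := by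
    intro y
    by_cases hy0 : y = 0
    · rw [hy0]; exact (le_max_right _ _).trans (le_max_left _ _)
    by_cases hy : y ∈ ball (0 : Euc n) (1 / 2)
    · exact (hM y hy hy0).2.trans ((le_max_left _ _).trans (le_max_left _ _))
    by_cases hyρ : y ∈ closedBall (0 : Euc n) ρ
    · exact (hA y ⟨hyρ, hy⟩).trans (le_max_right _ _)
    · have : g y = 0 := by
        by_contra hne
        exact hyρ (ball_subset_closedBall (hρ (subset_tsupport _ hne)))
      rw [this, abs_zero]
      exact (abs_nonneg (g 0)).trans ((le_max_right _ _).trans (le_max_left _ _))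
  have hV : ContDiff ℝ 1 fun x : Euc n => ∫ y, ‖x - y‖ ^ (-((n : ℝ) - 2)) * g y := by
    refine contDiff_one_integral_riesz_mul hn (by linarith) (by linarith) hgi.1 hbound
      (ρ := ρ) fun y hy => ?_
    by_contra hne
    have := hρ (subset_tsupport _ hne)
    rw [mem_ball_zero_iff] at this
    exact absurd this (not_lt.2 hy)
  rw [contDiff_iff_contDiffAt]
  intro x
  by_cases hx : x = 0
  · subst hx
    refine (hV.const_smul c⁻¹).contDiffAt.congr_of_eventuallyEq ?_
    filter_upwards [ball_mem_nhds (0 : Euc n) one_pos] with y hy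
    by_cases hy0 : y = 0
    · subst hy0; simp
    · rw [Function.update_of_ne hy0, smul_eq_mul, ← hrep y hy hy0,
        inv_mul_cancel_left₀ hc.ne']
  · have hux : ContDiffAt ℝ 1 u x :=
      (hu.2.1.contDiffAt (isOpen_compl_singleton.mem_nhds hx)).of_le (by norm_num)
    refine hux.congr_of_eventuallyEq ?_
    filter_upwards [isOpen_compl_singleton.mem_nhds hx] with y hy
    exact Function.update_of_ne hy _ _
end

section
/- Suppose n ≥ 3, α ∈ (0,n), λ > 0, and σ ≥ 0. Then there exists a nonnegative function u_λ ∈ C²(ℝⁿ\{0}) ∩ L^λ(ℝⁿ) that is a solution of the Choquard–Pekar inequality problem, vanishes on ℝⁿ\B₃(0), is harmonic on B₂(0)\{0} (indeed −Δu_λ = 0 there), and satisfies u_λ(x) = |x|^{−(n−2)} for 0 < |x| < 2 if 0 < λ < n/(n−2), and u_λ(x) = 1 for 0 < |x| < 2 if λ ≥ n/(n−2). Consequently, any pointwise bound φ for nonnegative solutions as x → 0 must satisfy φ(|x|) ≥ c·u_λ(x) near 0 for some c > 0. -/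
open MeasureTheory Metric Filter Set Asymptotics Topology

theorem hasFDerivAt_norm_rpow_of_ne_zero {E : Type*} [NormedAddCommGroup E]
    [InnerProductSpace ℝ E] (r : ℝ) {x : E} (hx : x ≠ 0) :
    HasFDerivAt (fun y : E => ‖y‖ ^ r) ((r * ‖x‖ ^ (r - 2)) • innerSL ℝ x) x := by
  have hpos : 0 < ‖x‖ := norm_pos_iff.mpr hx
  have h := (hasStrictFDerivAt_norm_sq x).hasFDerivAt.rpow_const (p := r / 2)
    (Or.inl (by positivity))
  have key : ∀ (t s : ℝ), 0 ≤ t → (t ^ 2) ^ s = t ^ (2 * s) := fun t s ht => by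
    rw [Real.rpow_mul ht, Real.rpow_two]
  convert h using 1
  · funext y
    rw [key _ _ (norm_nonneg y)]
    congr 1
    ring
  · rw [key _ _ hpos.le, show 2 * (r / 2 - 1) = r - 2 by ring]
    ext y
    simp
    ring

theorem lap_norm_rpow {n : ℕ} (r : ℝ) {x : Euc n} (hx : x ≠ 0) :
    lap (fun y : Euc n => ‖y‖ ^ r) x = r * (n + r - 2) * ‖x‖ ^ (r - 2) := by
  have hpos : 0 < ‖x‖ := norm_pos_iff.mpr hx
  have h1 : fderiv ℝ (fun y : Euc n => ‖y‖ ^ r) =ᶠ[𝓝 x]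
      fun y => (r * ‖y‖ ^ (r - 2)) • innerSL ℝ y := by
    filter_upwards [isOpen_ne.mem_nhds hx] with y hy
    exact (hasFDerivAt_norm_rpow_of_ne_zero r hy).fderiv
  have h2 := ((hasFDerivAt_norm_rpow_of_ne_zero (r - 2) hx).const_mul r).smul
    (innerSL ℝ (E := Euc n)).hasFDerivAt
  have h3 : ∑ i : Fin n, x i * x i = ‖x‖ ^ 2 := by
    rw [EuclideanSpace.real_norm_sq_eq]
    simp only [sq]
  have h4 : ‖x‖ ^ (r - 2) = ‖x‖ ^ (r - 2 - 2) * ‖x‖ ^ 2 := by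
    rw [← Real.rpow_two, ← Real.rpow_add hpos]
    congr 1
    ring
  have h5 : ∀ i : Fin n, iteratedFDeriv ℝ 2 (fun y : Euc n => ‖y‖ ^ r) x
      ![EuclideanSpace.single i 1, EuclideanSpace.single i 1] =
      r * ‖x‖ ^ (r - 2) + r * (r - 2) * ‖x‖ ^ (r - 2 - 2) * (x i * x i) := by
    intro i
    rw [iteratedFDeriv_two_apply, h1.fderiv_eq]
    erw [h2.fderiv]
    change r * ‖x‖ ^ (r - 2) * inner ℝ (EuclideanSpace.single i (1 : ℝ)) (EuclideanSpace.single i 1) +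
      r * ((r - 2) * ‖x‖ ^ (r - 2 - 2) * inner ℝ x (EuclideanSpace.single i 1)) *
        inner ℝ x (EuclideanSpace.single i 1) = _
    simp [EuclideanSpace.inner_single_right]
    ring
  unfold lap
  simp only [h5, Finset.sum_add_distrib, ← Finset.mul_sum, h3]
  simp
  rw [h4]
  ring

theorem Filter.EventuallyEq.lap_eq {n : ℕ} {u v : Euc n → ℝ} {x : Euc n}
    (h : u =ᶠ[𝓝 x] v) : lap u x = lap v x := by
  simp only [lap, (Filter.EventuallyEq.iteratedFDeriv ℝ h 2).self_of_nhds]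

theorem integrableOn_ball_norm_rpow {n : ℕ} (hn : 1 ≤ n) {s : ℝ} (hs : -(n : ℝ) < s) {R : ℝ}
    (hR : 0 < R) : IntegrableOn (fun x : Euc n => ‖x‖ ^ s) (ball 0 R) := by
  have : Nonempty (Fin n) := ⟨⟨0, hn⟩⟩
  have : Nontrivial (Euc n) := inferInstance
  rw [integrableOn_fun_norm_addHaar (volume : Measure (Euc n)) (f := fun t => t ^ s)]
  have h : IntegrableOn (fun t : ℝ => t ^ ((n : ℝ) - 1 + s)) (Ioo 0 R) :=
    (intervalIntegral.integrableOn_Ioo_rpow_iff hR).mpr (by linarith)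
  refine h.congr_fun (fun t ht => ?_) measurableSet_Ioo
  simp only [finrank_euclideanSpace, Fintype.card_fin, smul_eq_mul]
  rw [Real.rpow_add ht.1, ← Real.rpow_natCast, Nat.cast_sub hn, Nat.cast_one]

/-- A smooth cutoff equal to `1` on `B₂(0)` and vanishing outside `B₃(0)`. -/
noncomputable def cutoff (n : ℕ) : ContDiffBump (0 : Euc n) := ⟨2, 3, by norm_num, by norm_num⟩

theorem lap_cutoff_mul_norm_rpow {n : ℕ} {r : ℝ} (hr : r * (n + r - 2) = 0) {x : Euc n}
    (hx : x ∈ ball (0 : Euc n) 2 \ {0}) : lap (fun y => cutoff n y * ‖y‖ ^ r) x = 0 := by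
  have h : (fun y => cutoff n y * ‖y‖ ^ r) =ᶠ[𝓝 x] fun y => ‖y‖ ^ r := by
    filter_upwards [(cutoff n).eventuallyEq_one_of_mem_ball hx.1] with y hy
    rw [hy, Pi.one_apply, one_mul]
  rw [h.lap_eq, lap_norm_rpow r hx.2, hr, zero_mul]

theorem integrable_cutoff_mul_norm_rpow_rpow {n : ℕ} (hn : 1 ≤ n) {r lam : ℝ} (hlam : 0 < lam)
    (hr : -(n : ℝ) < r * lam) : Integrable (fun y => (cutoff n y * ‖y‖ ^ r) ^ lam) := by
  have hint : Integrable ((ball (0 : Euc n) 3).indicator fun y => ‖y‖ ^ (r * lam)) :=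
    (integrable_indicator_iff measurableSet_ball).mpr
      (integrableOn_ball_norm_rpow hn hr (by norm_num))
  refine hint.mono' ?_ (Eventually.of_forall fun y => ?_)
  · have := (cutoff n).continuous.measurable
    exact Measurable.aestronglyMeasurable (by fun_prop)
  · have h0 : 0 ≤ cutoff n y := (cutoff n).nonneg
    rw [Real.norm_of_nonneg (by positivity)]
    by_cases hy : y ∈ ball (0 : Euc n) 3
    · rw [indicator_of_mem hy, Real.mul_rpow h0 (by positivity), ← Real.rpow_mul (norm_nonneg y)]
      exact mul_le_of_le_one_left (by positivity)
        (Real.rpow_le_one h0 (cutoff n).le_one hlam.le)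
    · have hy0 : cutoff n y = 0 := (cutoff n).zero_of_le_dist (not_lt.mp hy)
      rw [indicator_of_notMem hy, hy0, zero_mul, Real.zero_rpow hlam.ne']

theorem isCPSolution_cutoff_mul_norm_rpow {n : ℕ} (hn : 1 ≤ n) (α sig : ℝ) {r lam : ℝ}
    (hlam : 0 < lam) (hr : -(n : ℝ) < r * lam) (hr0 : r * (n + r - 2) = 0) :
    IsCPSolution n α lam sig (fun y => cutoff n y * ‖y‖ ^ r) := by
  have hnonneg : ∀ y : Euc n, 0 ≤ cutoff n y * ‖y‖ ^ r := fun y =>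
    mul_nonneg (cutoff n).nonneg (Real.rpow_nonneg (norm_nonneg y) r)
  refine ⟨hnonneg, fun x hx => ?_, integrable_cutoff_mul_norm_rpow_rpow hn hlam hr,
    fun x hx => ?_⟩
  · exact ((cutoff n).contDiffAt.mul
      ((contDiffAt_norm ℝ hx).rpow_const_of_ne (norm_ne_zero_iff.mpr hx))).contDiffWithinAt
  · rw [lap_cutoff_mul_norm_rpow hr0 hx, neg_zero]
    exact ⟨le_rfl, mul_nonneg (integral_nonneg fun y =>
      mul_nonneg (Real.rpow_nonneg (norm_nonneg _) _) (Real.rpow_nonneg (hnonneg y) _))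
      (Real.rpow_nonneg (hnonneg x) _)⟩

theorem stmt17 (n : ℕ) (hn : 3 ≤ n) (α lam sig : ℝ)
    (hα0 : 0 < α) (hαn : α < n) (hlam : 0 < lam) (hsig : 0 ≤ sig) :
    ∃ u : Euc n → ℝ, IsCPSolution n α lam sig u ∧
      (∀ x : Euc n, x ∉ ball (0 : Euc n) 3 → u x = 0) ∧
      (∀ x ∈ ball (0 : Euc n) 2 \ {0}, lap u x = 0) ∧
      (∀ x : Euc n, x ≠ 0 → ‖x‖ < 2 →
        u x = if lam < (n : ℝ) / ((n : ℝ) - 2) then ‖x‖ ^ (-((n : ℝ) - 2)) else 1) ∧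
      (∀ φ : ℝ → ℝ,
        (∀ u' : Euc n → ℝ, IsCPSolution n α lam sig u' →
          ∃ C > (0:ℝ), ∃ δ > (0:ℝ), ∀ x : Euc n, x ≠ 0 → ‖x‖ < δ → u' x ≤ C * φ ‖x‖) →
        ∃ c > (0:ℝ), ∃ δ > (0:ℝ), ∀ x : Euc n, x ≠ 0 → ‖x‖ < δ → c * u x ≤ φ ‖x‖) := by
  have hn2 : (0 : ℝ) < (n : ℝ) - 2 := by
    have : (3 : ℝ) ≤ n := by exact_mod_cast hn
    linarith
  obtain ⟨r, hr, hr0, hval⟩ : ∃ r : ℝ, -(n : ℝ) < r * lam ∧ r * (n + r - 2) = 0 ∧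
      ∀ t : ℝ, t ^ r = if lam < (n : ℝ) / ((n : ℝ) - 2) then t ^ (-((n : ℝ) - 2)) else 1 := by
    by_cases h : lam < (n : ℝ) / ((n : ℝ) - 2)
    · rw [lt_div_iff₀ hn2] at h
      exact ⟨-((n : ℝ) - 2), by linarith, by ring, fun t => by
        rw [if_pos ((lt_div_iff₀ hn2).mpr h)]⟩
    · exact ⟨0, by linarith, by ring, fun t => by rw [if_neg h, Real.rpow_zero]⟩
  have hsol := isCPSolution_cutoff_mul_norm_rpow (by omega : 1 ≤ n) α sig hlam hr hr0
  refine ⟨fun y => cutoff n y * ‖y‖ ^ r, hsol, fun x hx => ?_,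
    fun x hx => lap_cutoff_mul_norm_rpow hr0 hx, fun x _ hx => ?_, fun φ hφ => ?_⟩
  · have hx0 : cutoff n x = 0 := (cutoff n).zero_of_le_dist (not_lt.mp hx)
    simp only [hx0, zero_mul]
  · have hx1 : cutoff n x = 1 :=
      (cutoff n).one_of_mem_closedBall (mem_closedBall_zero_iff.mpr hx.le)
    simp only [hx1, one_mul]
    exact hval _
  · obtain ⟨C, hC, δ, hδ, h⟩ := hφ _ hsol
    exact ⟨C⁻¹, inv_pos.mpr hC, δ, hδ, fun x hx hxδ =>
      (inv_mul_le_iff₀ hC).mpr (h x hx hxδ)⟩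
end
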